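/- arXiv:2204.13538 — 11 statements merged into one kernel-verified Lean document; each statement's English description precedes it below -/
import Mathlib

section
/- Let p be a prime, λ a positive multiple of p, m ≥ 1, and let f, f' : {0,1,...,p-1}^m → ℤ_λ be multivariate functions. Let J = {j_0,...,j_{n-1}} ⊆ {0,...,m-1}. Then for every integer τ with |τ| < p^m, the aperiodic cross-correlation satisfies Θ(ψ(f), ψ(f'))(τ) = Σ_{c1 ∈ {0,...,p-1}^n} Σ_{c2 ∈ {0,...,p-1}^n} Θ(ψ(f|_{x_J=c1}), ψ(f'|_{x_J=c2}))(τ). -/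
open Finset

noncomputable section

namespace QCCS

/-- The base-`p` digit vector (most significant digit first) of a natural number `i`,
viewed as an element of `{0,...,p-1}^m`. -/
def digitVec (p m : ℕ) [NeZero p] (i : ℕ) : Fin m → Fin p :=
  fun a => ⟨i / p ^ (m - 1 - (a : ℕ)) % p, Nat.mod_lt _ (Nat.pos_of_ne_zero (NeZero.ne p))⟩

/-- The primitive `lam`-th root of unity `exp(2πi/lam)`. -/
def zeta (lam : ℕ) : ℂ := Complex.exp (2 * Real.pi * Complex.I / lam)

/-- The complex sequence `ψ(f)` of length `p^m` associated with a multivariate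
function `f : {0,...,p-1}^m → ℤ_lam`; entry `i` is `ξ_lam^(f(i_0,...,i_{m-1}))`. -/
def psi (p lam m : ℕ) [NeZero p] (f : (Fin m → Fin p) → ZMod lam) : ℕ → ℂ :=
  fun i => zeta lam ^ (f (digitVec p m i)).val

/-- The restricted sequence `ψ(f|_{x_J = c})`: entry `i` is `ξ_lam^(f(i_0,...,i_{m-1}))`
if the digits of `i` at the positions listed by `J` agree with `c`, and `0` otherwise. -/
def psiRes (p lam m n : ℕ) [NeZero p] (f : (Fin m → Fin p) → ZMod lam)
    (J : Fin n → Fin m) (c : Fin n → Fin p) : ℕ → ℂ :=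
  fun i => if ∀ a, digitVec p m i (J a) = c a then psi p lam m f i else 0

/-- Aperiodic cross-correlation of two length-`L` complex sequences at (integer) shift `τ`. -/
def corr (L : ℕ) (a b : ℕ → ℂ) (τ : ℤ) : ℂ :=
  ∑ i ∈ Finset.range L,
    if 0 ≤ (i : ℤ) + τ ∧ (i : ℤ) + τ < (L : ℤ) then
      a ((i : ℤ) + τ).toNat * (starRingEnd ℂ) (b i)
    else 0

theorem psi_eq_sum (p lam m n : ℕ) [NeZero p] (f : (Fin m → Fin p) → ZMod lam)
    (J : Fin n → Fin m) (i : ℕ) :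
    psi p lam m f i = ∑ c : Fin n → Fin p, psiRes p lam m n f J c i := by
  unfold psiRes
  rw [Finset.sum_eq_single (fun a => digitVec p m i (J a))]
  · simp
  · intro c _ hc
    rw [if_neg]
    intro h
    exact hc (funext fun a => (h a).symm)
  · simp

theorem stmt0 {p lam m n : ℕ} [NeZero p] (hp : p.Prime)
    (hlam : 0 < lam) (hdvd : p ∣ lam) (hm : 1 ≤ m)
    (f f' : (Fin m → Fin p) → ZMod lam)
    (J : Fin n → Fin m) (hJ : Function.Injective J)
    (τ : ℤ) (hτ : |τ| < (p : ℤ) ^ m) :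
    corr (p ^ m) (psi p lam m f) (psi p lam m f') τ =
      ∑ c1 : Fin n → Fin p, ∑ c2 : Fin n → Fin p,
        corr (p ^ m) (psiRes p lam m n f J c1) (psiRes p lam m n f' J c2) τ := by
  unfold corr
  simp_rw [Finset.sum_comm (s := (Finset.univ : Finset (Fin n → Fin p))) (t := Finset.range (p ^ m))]
  refine Finset.sum_congr rfl fun i _ => ?_
  split_ifs with h
  · rw [psi_eq_sum p lam m n f J, psi_eq_sum p lam m n f' J, map_sum, Finset.sum_mul_sum]
  · simp
end QCCS
end
end

section
/- Let p be an odd prime, λ a positive multiple of p, m ≥ 1, 0 ≤ n ≤ m-1, and J = {j_0,...,j_{n-1}} ⊆ {0,...,m-1}. Suppose f : {0,1,...,p-1}^m → ℤ_λ satisfies the Hamiltonian-path condition with respect to J with permutation π. Then for every k ∈ {1,...,p-1}, the collection 𝒞^k = {ψ(C_t^k) : t = 0,1,...,p^{n+1}-1} is a (p^{n+1}, p^m)-CCC over ℤ_λ; explicitly, for all t, t' ∈ {0,...,p^{n+1}-1} and all integers τ with |τ| < p^m, the code cross-correlation Θ(ψ(C_t^k), ψ(C_{t'}^k))(τ) equals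 p^{m+n+1} if τ = 0 and t = t', and equals 0 otherwise. -/
open Finset

noncomputable section

namespace QCCS

/-- `f` satisfies the Hamiltonian-path condition with respect to `J` (with the non-`J`
variable positions enumerated by `l` and permutation `π`): every restriction
`f|_{x_J = c}` equals `(lam/p) Σ_{a=0}^{m-n-2} x_{l(π(a))} x_{l(π(a+1))}
+ Σ_{a=0}^{m-n-1} g_a(c) x_{l(a)} + g'(c)` as a function of the unrestricted variables. -/
def hamiltonianPathCond (p lam m n : ℕ) [NeZero p]
    (f : (Fin m → Fin p) → ZMod lam) (J : Fin n → Fin m)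
    (l : Fin (m - n) → Fin m) (π : Equiv.Perm (Fin (m - n))) : Prop :=
  ∀ c : Fin n → Fin p, ∃ g : Fin (m - n) → ZMod lam, ∃ g' : ZMod lam,
    ∀ x : Fin m → Fin p, (∀ a, x (J a) = c a) →
      f x = ((lam / p * ∑ a : Fin (m - n),
            (if h : (a : ℕ) + 1 < m - n then
              (x (l (π a)) : ℕ) * (x (l (π ⟨(a : ℕ) + 1, h⟩)) : ℕ)
            else 0) : ℕ) : ZMod lam)
        + (∑ a : Fin (m - n), g a * ((x (l a) : ℕ) : ZMod lam)) + g'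

/-- The member of the code `C_t^k` indexed by `d ∈ {0,...,p^{n+1}-1}`:
`f + (kλ/p)(𝐝·𝐱_J + d_n x_{l0}) + (λ/p)(𝐭·𝐱_J + t_n x_{lN})`, where
`(d_0,...,d_n)` and `(t_0,...,t_n)` are the base-`p` digit vectors of `d` and `t`. -/
def codeword (p lam m n : ℕ) [NeZero p] (f : (Fin m → Fin p) → ZMod lam)
    (J : Fin n → Fin m) (l0 lN : Fin m) (k d t : ℕ) : (Fin m → Fin p) → ZMod lam :=
  fun x => f x
    + (((k * (lam / p) *
        ((∑ a : Fin n, (digitVec p (n + 1) d a.castSucc : ℕ) * (x (J a) : ℕ))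
          + (digitVec p (n + 1) d (Fin.last n) : ℕ) * (x l0 : ℕ))) : ℕ) : ZMod lam)
    + (((lam / p *
        ((∑ a : Fin n, (digitVec p (n + 1) t a.castSucc : ℕ) * (x (J a) : ℕ))
          + (digitVec p (n + 1) t (Fin.last n) : ℕ) * (x lN : ℕ))) : ℕ) : ZMod lam)

/-- The additive character on `ZMod lam`. -/
def ee (lam : ℕ) (a : ZMod lam) : ℂ := zeta lam ^ a.val

lemma ee_eq (lam : ℕ) [NeZero lam] (a : ZMod lam) : ee lam a = ZMod.stdAddChar a := by
  rw [ee, zeta, ZMod.stdAddChar_apply, ZMod.toCircle_apply, ← Complex.exp_nat_mul]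
  congr 1
  ring

lemma ee_add (lam : ℕ) [NeZero lam] (a b : ZMod lam) : ee lam (a + b) = ee lam a * ee lam b := by
  simp only [ee_eq, AddChar.map_add_eq_mul]

lemma ee_zero (lam : ℕ) [NeZero lam] : ee lam 0 = 1 := by
  simp only [ee_eq, AddChar.map_zero_eq_one]

lemma ee_sum (lam : ℕ) [NeZero lam] {ι : Type*} (s : Finset ι) (F : ι → ZMod lam) :
    ee lam (∑ i ∈ s, F i) = ∏ i ∈ s, ee lam (F i) := by
  classical
  induction s using Finset.induction_on with
  | empty => simp [ee_zero]
  | insert a s ha ih => rw [Finset.sum_insert ha, Finset.prod_insert ha, ee_add, ih]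

lemma ee_conj (lam : ℕ) [NeZero lam] (b : ZMod lam) :
    (starRingEnd ℂ) (ee lam b) = ee lam (-b) := by
  rw [ee_eq, ee_eq, AddChar.map_neg_eq_conj]

lemma p_mul_h {p lam : ℕ} (hdvd : p ∣ lam) :
    ((lam / p : ℕ) : ZMod lam) * (p : ZMod lam) = 0 := by
  rw [← Nat.cast_mul, Nat.div_mul_cancel hdvd]; simp

lemma h_val {p lam : ℕ} [NeZero p] (hdvd : p ∣ lam) (u s : Fin p) :
    ((lam / p : ℕ) : ZMod lam) * (((u + s : Fin p) : ℕ) : ZMod lam)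
      = ((lam / p : ℕ) : ZMod lam) * ((u : ℕ) + (s : ℕ)) := by
  have h1 := Nat.mod_add_div ((u : ℕ) + s) p
  have h2 : (((u : ℕ) + (s : ℕ) : ℕ) : ZMod lam)
      = (((u + s : Fin p) : ℕ) : ZMod lam) + p * (((u : ℕ) + s) / p : ℕ) := by
    rw [Fin.val_add]
    conv_lhs => rw [← h1]
    push_cast
    ring
  rw [← Nat.cast_add, h2, mul_add, ← mul_assoc, p_mul_h hdvd]
  ring

lemma orth {p lam : ℕ} (hp : p.Prime) (hlam : 0 < lam) (hdvd : p ∣ lam)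
    (k : ℕ) (hk : ¬ p ∣ k) (a b : Fin p) :
    ∑ s : Fin p, ee lam (((lam / p : ℕ) : ZMod lam) * k * (s : ℕ) * ((a : ℕ) - (b : ℕ)))
      = if a = b then (p : ℂ) else 0 := by
  haveI : NeZero lam := ⟨hlam.ne'⟩
  by_cases hab : a = b
  · subst hab
    simp [ee_zero]
  rw [if_neg hab]
  set w := ee lam (((lam / p : ℕ) : ZMod lam) * k * ((a : ℕ) - (b : ℕ))) with hw
  have hpow : ∀ s : ℕ, ee lam (((lam / p : ℕ) : ZMod lam) * k * (s : ℕ) * ((a : ℕ) - (b : ℕ)))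
      = w ^ s := by
    intro s
    rw [hw, ee_eq, ee_eq, ← AddChar.map_nsmul_eq_pow]
    congr 1
    rw [nsmul_eq_mul]
    ring
  have hw1 : w ≠ 1 := by
    intro h
    rw [hw, ee_eq, ← AddChar.map_zero_eq_one (ZMod.stdAddChar (N := lam))] at h
    have h0 := ZMod.injective_stdAddChar h
    have h1 : ((((lam / p : ℕ) : ℤ) * ((k : ℤ) * ((a : ℕ) - (b : ℕ) : ℤ)) : ℤ) : ZMod lam) = 0 := by
      rw [Int.cast_mul, Int.cast_natCast, ← h0]
      push_cast
      ring
    rw [ZMod.intCast_zmod_eq_zero_iff_dvd] at h1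
    obtain ⟨q, rfl⟩ := hdvd
    have hq : 0 < q := Nat.pos_of_mul_pos_left hlam
    rw [Nat.mul_div_cancel_left _ hp.pos] at h1
    push_cast at h1
    rw [mul_comm (p : ℤ)] at h1
    have h2 := Int.dvd_of_mul_dvd_mul_left (by exact_mod_cast hq.ne') h1
    rcases (Nat.prime_iff_prime_int.mp hp).dvd_or_dvd h2 with h3 | h3
    · exact hk (by exact_mod_cast h3)
    · apply hab
      have ha := a.2
      have hb := b.2
      have h4 := Int.eq_zero_of_abs_lt_dvd h3 (by rw [abs_lt]; constructor <;> omega)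
      ext; omega
  have hwp : w ^ p = 1 := by
    rw [← hpow]
    rw [mul_right_comm _ (k : ZMod lam), p_mul_h hdvd]
    simp [ee_zero]
  rw [Finset.sum_congr rfl (fun (s : Fin p) _ => hpow (s : ℕ)), Fin.sum_univ_eq_sum_range (fun i => w ^ i),
    geom_sum_eq hw1, hwp]
  simp

lemma orth_pi {p lam : ℕ} (hp : p.Prime) (hlam : 0 < lam) (hdvd : p ∣ lam)
    (k : ℕ) (hk : ¬ p ∣ k) (M : ℕ) (a b : Fin M → Fin p) :
    ∑ D : Fin M → Fin p, ee lam (∑ i, ((lam / p : ℕ) : ZMod lam) * k * (D i : ℕ) *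
        ((a i : ℕ) - (b i : ℕ)))
      = if ∀ i, a i = b i then (p : ℂ) ^ M else 0 := by
  haveI : NeZero lam := ⟨hlam.ne'⟩
  simp only [ee_sum]
  have := Finset.prod_univ_sum (fun _ : Fin M => (Finset.univ : Finset (Fin p)))
    (fun i s => ee lam (((lam / p : ℕ) : ZMod lam) * k * (s : ℕ) * ((a i : ℕ) - (b i : ℕ))))
  rw [Fintype.piFinset_univ] at this
  rw [← this]
  simp only [orth hp hlam hdvd k hk]
  split_ifs with h
  · simp [h]
  · push Not at h
    obtain ⟨i, hi⟩ := h
    exact Finset.prod_eq_zero (Finset.mem_univ i) (if_neg hi)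

lemma avg {X : Type*} [Fintype X] {p : ℕ} [NeZero p] (F : X → ℂ) (σ : Fin p → Equiv.Perm X)
    (h : ∀ x, ∑ s, F (σ s x) = 0) : ∑ x, F x = 0 := by
  have h1 : ∑ s : Fin p, ∑ x, F (σ s x) = 0 := by
    rw [Finset.sum_comm]
    exact Finset.sum_eq_zero fun x _ => h x
  have h2 : ∀ s : Fin p, ∑ x, F (σ s x) = ∑ x, F x := fun s => Equiv.sum_comp (σ s) F
  simp only [h2, Finset.sum_const, Finset.card_univ, Fintype.card_fin, nsmul_eq_mul] at h1
  rcases mul_eq_zero.mp h1 with h3 | h3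
  · exact absurd (by exact_mod_cast h3) (NeZero.ne p)
  · exact h3

/-- the number with digit vector `x`. -/
def num (p m : ℕ) (x : Fin m → Fin p) : ℕ := ∑ a, (x a : ℕ) * p ^ (m - 1 - (a : ℕ))

/-- digit bijection. -/
def dE (p m : ℕ) : Fin (p ^ m) ≃ (Fin m → Fin p) :=
  finFunctionFinEquiv.symm.trans (Equiv.arrowCongr Fin.revPerm (Equiv.refl _))

lemma dE_apply (p m : ℕ) [NeZero p] (i : Fin (p ^ m)) : dE p m i = digitVec p m i := by
  ext a
  simp [dE, digitVec, finFunctionFinEquiv, Equiv.arrowCongr, Fin.val_rev]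
  rw [show m - (↑a + 1) = m - 1 - (a : ℕ) by omega]

lemma num_dE (p m : ℕ) (i : Fin (p ^ m)) : num p m (dE p m i) = i := by
  obtain ⟨x, rfl⟩ := (finFunctionFinEquiv (m := p) (n := m)).surjective i
  rw [finFunctionFinEquiv_apply, num, ← Equiv.sum_comp Fin.revPerm]
  refine Finset.sum_congr rfl fun a _ => ?_
  simp [dE, Equiv.arrowCongr, Fin.val_rev]
  left
  congr 1
  omega

lemma num_inj (p m : ℕ) {x y : Fin m → Fin p} (h : num p m x = num p m y) : x = y := by
  obtain ⟨i, rfl⟩ := (dE p m).surjective x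
  obtain ⟨j, rfl⟩ := (dE p m).surjective y
  rw [num_dE, num_dE] at h
  rw [Fin.ext h]

lemma sum_digit (p m : ℕ) [NeZero p] (G : ℕ → (Fin m → Fin p) → ℂ) :
    ∑ i ∈ Finset.range (p ^ m), G i (digitVec p m i) = ∑ x, G (num p m x) x := by
  rw [← Fin.sum_univ_eq_sum_range (fun i => G i (digitVec p m i)), ← Equiv.sum_comp (dE p m)]
  refine Finset.sum_congr rfl fun i _ => ?_
  rw [num_dE, dE_apply]

lemma corr_eq (p lam m : ℕ) [NeZero p] [NeZero lam] (F G : (Fin m → Fin p) → ZMod lam) (τ : ℤ) :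
    corr (p ^ m) (psi p lam m F) (psi p lam m G) τ
      = ∑ x, ∑ y, if (num p m x : ℤ) = num p m y + τ then ee lam (F x - G y) else 0 := by
  have h1 : corr (p ^ m) (psi p lam m F) (psi p lam m G) τ
      = ∑ i ∈ Finset.range (p ^ m), ∑ j ∈ Finset.range (p ^ m),
        if (j : ℤ) = i + τ then ee lam (F (digitVec p m j) - G (digitVec p m i)) else 0 := by
    refine Finset.sum_congr rfl fun i _ => ?_
    split_ifs with h
    · rw [Finset.sum_eq_single_of_mem ((i : ℤ) + τ).toNat]
      · rw [if_pos (by omega), sub_eq_add_neg, ee_add, ← ee_conj]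
        rfl
      · rw [Finset.mem_range]
        have h3 := h.2
        omega
      · intro j _ hj
        rw [if_neg]
        omega
    · symm
      apply Finset.sum_eq_zero
      intro j hj
      rw [if_neg]
      intro h2
      apply h
      rw [Finset.mem_range] at hj
      rw [← h2]
      exact ⟨by omega, by exact_mod_cast hj⟩
  rw [h1, Finset.sum_comm (s := Finset.univ)]
  rw [sum_digit p m (fun i x => ∑ j ∈ Finset.range (p ^ m),
        if (j : ℤ) = i + τ then ee lam (F (digitVec p m j) - G x) else 0)]
  refine Finset.sum_congr rfl fun y _ => ?_
  rw [sum_digit p m (fun j x => 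
        if (j : ℤ) = num p m y + τ then ee lam (F x - G y) else 0)]

/-- shift of one coordinate. -/
def sh {p m : ℕ} [NeZero p] (a : Fin m) (s : Fin p) : Equiv.Perm (Fin m → Fin p) :=
  Equiv.addRight (Pi.single a s)

lemma sh_same {p m : ℕ} [NeZero p] (a : Fin m) (s : Fin p) (x : Fin m → Fin p) :
    sh a s x a = x a + s := by simp [sh]

lemma sh_ne {p m : ℕ} [NeZero p] (a b : Fin m) (s : Fin p) (x : Fin m → Fin p) (h : b ≠ a) :
    sh a s x b = x b := by simp [sh, h]

lemma sh_iff {p m : ℕ} [NeZero p] (a b : Fin m) (s : Fin p) (x y : Fin m → Fin p) :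
    sh a s x b = sh a s y b ↔ x b = y b := by simp [sh]

lemma sh_sub {p m : ℕ} [NeZero p] {R : Type*} [Ring R] (a b : Fin m) (s : Fin p)
    (x y : Fin m → Fin p)
    (h : x a = y a) : ((sh a s x b : ℕ) : R) - (sh a s y b : ℕ) = (x b : ℕ) - (y b : ℕ) := by
  by_cases hb : b = a
  · subst hb
    rw [sh_same, sh_same, h]; simp
  · rw [sh_ne _ _ _ _ hb, sh_ne _ _ _ _ hb]

lemma sh_num {p m : ℕ} [NeZero p] (a : Fin m) (s : Fin p)
    (x y : Fin m → Fin p) (h : x a = y a) :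
    (num p m (sh a s x) : ℤ) - num p m (sh a s y) = num p m x - num p m y := by
  simp only [num]
  push_cast
  rw [← Finset.sum_sub_distrib, ← Finset.sum_sub_distrib]
  refine Finset.sum_congr rfl fun b _ => ?_
  rw [← sub_mul, ← sub_mul, sh_sub a b s x y h]

/-- product of consecutive path variables. -/
def pt (p m N : ℕ) (P : Fin N → Fin m) (x : Fin m → Fin p) (b : Fin N) : ℕ :=
  if h : (b : ℕ) + 1 < N then (x (P b) : ℕ) * (x (P ⟨(b : ℕ) + 1, h⟩) : ℕ) else 0

lemma pt_shift {p lam m N : ℕ} [NeZero p] (hdvd : p ∣ lam) (P : Fin N → Fin m)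
    (hP : Function.Injective P) (j : ℕ) (hj : j + 1 < N) (s : Fin p) (x y : Fin m → Fin p)
    (hxy : ∀ b : Fin N, (b : ℕ) < j + 1 → x (P b) = y (P b)) :
    ((lam / p : ℕ) : ZMod lam) * (∑ b, (pt p m N P (sh (P ⟨j, by omega⟩) s x) b : ZMod lam))
      - ((lam / p : ℕ) : ZMod lam) * (∑ b, (pt p m N P (sh (P ⟨j, by omega⟩) s y) b : ZMod lam))
    = ((lam / p : ℕ) : ZMod lam) * (∑ b, (pt p m N P x b : ZMod lam))
      - ((lam / p : ℕ) : ZMod lam) * (∑ b, (pt p m N P y b : ZMod lam))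
      + ((lam / p : ℕ) : ZMod lam) * (s : ℕ) *
        ((x (P ⟨j + 1, hj⟩) : ℕ) - (y (P ⟨j + 1, hj⟩) : ℕ)) := by
  have key : ∀ b : Fin N,
      ((lam / p : ℕ) : ZMod lam) * (pt p m N P (sh (P ⟨j, by omega⟩) s x) b : ZMod lam)
      - ((lam / p : ℕ) : ZMod lam) * (pt p m N P (sh (P ⟨j, by omega⟩) s y) b : ZMod lam)
      = (((lam / p : ℕ) : ZMod lam) * (pt p m N P x b : ZMod lam)
      - ((lam / p : ℕ) : ZMod lam) * (pt p m N P y b : ZMod lam))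
      + if b = ⟨j, by omega⟩ then ((lam / p : ℕ) : ZMod lam) * (s : ℕ) *
        ((x (P ⟨j + 1, hj⟩) : ℕ) - (y (P ⟨j + 1, hj⟩) : ℕ)) else 0 := by
    intro b
    by_cases hbj : b = ⟨j, by omega⟩
    · subst hbj
      rw [if_pos rfl]
      have hne : P ⟨j + 1, hj⟩ ≠ P ⟨j, by omega⟩ := fun h => by
        have := hP h
        simp at this
      simp only [pt, hj, dif_pos]
      rw [sh_ne _ _ _ _ hne, sh_ne _ _ _ _ hne, sh_same, sh_same]
      have h1 := hxy ⟨j, by omega⟩ (by simp)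
      push_cast
      rw [← mul_assoc, ← mul_assoc, h_val hdvd, h_val hdvd, h1]
      ring
    · rw [if_neg hbj, add_zero]
      have hne : P b ≠ P ⟨j, by omega⟩ := fun h => hbj (hP h)
      by_cases hb : (b : ℕ) + 1 < N
      · simp only [pt, hb, dif_pos]
        rw [sh_ne _ _ _ _ hne, sh_ne _ _ _ _ hne]
        by_cases hb1 : (b : ℕ) + 1 = j
        · have e1 : x (P b) = y (P b) := hxy b (by omega)
          have h1 := hxy ⟨j, by omega⟩ (by simp)
          simp only [hb1, sh_same, e1, h1, sub_self]
        · have hne2 : P ⟨(b : ℕ) + 1, hb⟩ ≠ P ⟨j, by omega⟩ := fun h => by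
            have := hP h
            simp at this
            omega
          rw [sh_ne _ _ _ _ hne2, sh_ne _ _ _ _ hne2]
      · simp [pt, hb]
  rw [Finset.mul_sum, Finset.mul_sum, Finset.mul_sum, Finset.mul_sum, ← Finset.sum_sub_distrib,
    ← Finset.sum_sub_distrib, Finset.sum_congr rfl (fun b _ => key b), Finset.sum_add_distrib]
  simp

/-- exponent after removing the `d`-sum. -/
def BB {p lam m n : ℕ} (f : (Fin m → Fin p) → ZMod lam) (r : Fin (n + 1) → Fin m)
    (T T' : Fin (n + 1) → Fin p) (x y : Fin m → Fin p) : ZMod lam :=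
  f x - f y + (∑ i, ((lam / p : ℕ) : ZMod lam) * (T i : ℕ) * (x (r i) : ℕ)
    - ∑ i, ((lam / p : ℕ) : ZMod lam) * (T' i : ℕ) * (y (r i) : ℕ))

/-- pair condition. -/
def CC {p m n N : ℕ} (J : Fin n → Fin m) (P : Fin N → Fin m) (τ : ℤ) (j : ℕ)
    (x y : Fin m → Fin p) : Prop :=
  (num p m x : ℤ) = num p m y + τ ∧ (∀ a, x (J a) = y (J a)) ∧
    ∀ b : Fin N, (b : ℕ) < j → x (P b) = y (P b)

lemma sum_differ {p lam m n : ℕ} [NeZero p] (hp : p.Prime) (hlam : 0 < lam) (hdvd : p ∣ lam)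
    (f : (Fin m → Fin p) → ZMod lam)
    (J : Fin n → Fin m)
    (l : Fin (m - n) → Fin m) (hl : Function.Injective l)
    (hcompl : ∀ i : Fin m, (∃ b, l b = i) ↔ ¬∃ a, J a = i)
    (π : Equiv.Perm (Fin (m - n)))
    (hHPC : hamiltonianPathCond p lam m n f J l π)
    (r : Fin (n + 1) → Fin m) (T T' : Fin (n + 1) → Fin p) (τ : ℤ)
    (j : ℕ) (hj : j + 1 < m - n) (hr : ∀ i, r i ≠ l (π ⟨j, by omega⟩)) :
    (∑ z : (Fin m → Fin p) × (Fin m → Fin p), open Classical in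
      if CC J (fun b => l (π b)) τ (j + 1) z.1 z.2 ∧
        z.1 (l (π ⟨j + 1, hj⟩)) ≠ z.2 (l (π ⟨j + 1, hj⟩)) then
      ee lam (BB f r T T' z.1 z.2) else 0) = 0 := by
  classical
  haveI : NeZero lam := ⟨hlam.ne'⟩
  set P : Fin (m - n) → Fin m := fun b => l (π b) with hPdef
  have hP : Function.Injective P := hl.comp π.injective
  set a := P ⟨j, by omega⟩ with ha
  have haJ : ∀ i, J i ≠ a := fun i h => (hcompl a).mp ⟨_, rfl⟩ ⟨i, h⟩
  apply avg (p := p) _ (fun s => Equiv.prodCongr (sh a s) (sh a s))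
  rintro ⟨x, y⟩
  simp only [Equiv.prodCongr_apply, Prod.map]
  by_cases hxa : x a = y a
  swap
  · apply Finset.sum_eq_zero
    intro s _
    rw [if_neg]
    rintro ⟨⟨-, -, h⟩, -⟩
    exact hxa ((sh_iff _ _ _ _ _).mp (h ⟨j, by omega⟩ (by simp)))
  have hcond : ∀ s : Fin p, (CC J P τ (j + 1) (sh a s x) (sh a s y) ∧
      sh a s x (l (π ⟨j + 1, hj⟩)) ≠ sh a s y (l (π ⟨j + 1, hj⟩))) ↔
      (CC J P τ (j + 1) x y ∧ x (l (π ⟨j + 1, hj⟩)) ≠ y (l (π ⟨j + 1, hj⟩))) := by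
    intro s
    have := sh_num a s x y hxa
    simp only [CC, ne_eq, sh_iff]
    have h2 : (num p m (sh a s x) : ℤ) = num p m (sh a s y) + τ ↔
      (num p m x : ℤ) = num p m y + τ := by constructor <;> intro h <;> linarith
    rw [h2]
  simp only [hcond]
  split_ifs with hc
  swap
  · simp
  obtain ⟨⟨-, hcJ, hcP⟩, hne⟩ := hc
  have hB : ∀ s : Fin p, BB f r T T' (sh a s x) (sh a s y) = BB f r T T' x y +
      ((lam / p : ℕ) : ZMod lam) * (1 : ℕ) * (s : ℕ) *
        ((x (P ⟨j + 1, hj⟩) : ℕ) - (y (P ⟨j + 1, hj⟩) : ℕ)) := by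
    intro s
    obtain ⟨g, g', hg⟩ := hHPC (fun i => x (J i))
    have e1 := hg x (fun _ => rfl)
    have e2 := hg y (fun i => (hcJ i).symm)
    have e3 := hg (sh a s x) (fun i => sh_ne _ _ _ _ (haJ i))
    have e4 := hg (sh a s y) (fun i => by rw [sh_ne _ _ _ _ (haJ i), hcJ])
    have hpt := pt_shift hdvd P hP j hj s x y hcP
    have hgs : (∑ b, g b * ((sh a s x (l b) : ℕ) : ZMod lam))
        - (∑ b, g b * ((sh a s y (l b) : ℕ) : ZMod lam))
        = (∑ b, g b * ((x (l b) : ℕ) : ZMod lam)) - (∑ b, g b * ((y (l b) : ℕ) : ZMod lam)) := by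
      rw [← Finset.sum_sub_distrib, ← Finset.sum_sub_distrib]
      refine Finset.sum_congr rfl fun b _ => ?_
      rw [← mul_sub, ← mul_sub, sh_sub a _ s x y hxa]
    have hE : ∀ z : Fin m → Fin p, (((lam / p * ∑ b : Fin (m - n),
            (if h : (b : ℕ) + 1 < m - n then
              (z (l (π b)) : ℕ) * (z (l (π ⟨(b : ℕ) + 1, h⟩)) : ℕ)
            else 0) : ℕ)) : ZMod lam)
        = ((lam / p : ℕ) : ZMod lam) * (∑ b, (pt p m (m - n) P z b : ZMod lam)) := by
      intro z
      rw [Nat.cast_mul, Nat.cast_sum]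
      rfl
    rw [hE] at e1 e2 e3 e4
    have hr' : ∀ i, ∀ z : Fin m → Fin p, sh a s z (r i) = z (r i) :=
      fun i z => sh_ne _ _ _ _ (hr i)
    simp only [BB, hr']
    rw [e1, e2, e3, e4]
    rw [Nat.cast_one, mul_one]
    linear_combination hpt + hgs
  simp only [hB, ee_add]
  rw [← Finset.mul_sum, orth hp hlam hdvd 1 (by simpa using hp.one_lt.ne'), if_neg hne, mul_zero]

lemma step_all {p lam m n : ℕ} [NeZero p] (hp : p.Prime) (hlam : 0 < lam) (hdvd : p ∣ lam)
    (f : (Fin m → Fin p) → ZMod lam)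
    (J : Fin n → Fin m)
    (l : Fin (m - n) → Fin m) (hl : Function.Injective l)
    (hcompl : ∀ i : Fin m, (∃ b, l b = i) ↔ ¬∃ a, J a = i)
    (π : Equiv.Perm (Fin (m - n)))
    (hHPC : hamiltonianPathCond p lam m n f J l π)
    (r : Fin (n + 1) → Fin m) (T T' : Fin (n + 1) → Fin p) (τ : ℤ)
    (hr : ∀ j (hj : j + 1 < m - n), ∀ i, r i ≠ l (π ⟨j, by omega⟩)) (j : ℕ) (hj : j + 1 ≤ m - n) :
    (∑ z : (Fin m → Fin p) × (Fin m → Fin p), open Classical in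
      if CC J (fun b => l (π b)) τ 1 z.1 z.2 then ee lam (BB f r T T' z.1 z.2) else 0)
    = (∑ z : (Fin m → Fin p) × (Fin m → Fin p), open Classical in
      if CC J (fun b => l (π b)) τ (j + 1) z.1 z.2 then ee lam (BB f r T T' z.1 z.2) else 0) := by
  classical
  induction j with
  | zero => rfl
  | succ j ih =>
    rw [ih (by omega)]
    have h0 := sum_differ hp hlam hdvd f J l hl hcompl π hHPC r T T' τ j (by omega)
      (hr j (by omega))
    rw [← sub_eq_zero, ← Finset.sum_sub_distrib]
    refine Eq.trans ?_ h0
    refine Finset.sum_congr rfl fun z _ => ?_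
    have hiff : CC J (fun b => l (π b)) τ (j + 1 + 1) z.1 z.2 ↔
        CC J (fun b => l (π b)) τ (j + 1) z.1 z.2 ∧
        z.1 (l (π ⟨j + 1, by omega⟩)) = z.2 (l (π ⟨j + 1, by omega⟩)) := by
      constructor
      · rintro ⟨h1, h2, h3⟩
        exact ⟨⟨h1, h2, fun b hb => h3 b (by omega)⟩, h3 ⟨j + 1, by omega⟩ (by simp)⟩
      · rintro ⟨⟨h1, h2, h3⟩, h4⟩
        refine ⟨h1, h2, fun b hb => ?_⟩
        rcases Nat.lt_succ_iff_lt_or_eq.mp hb with h | h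
        · exact h3 b h
        · have : b = ⟨j + 1, by omega⟩ := Fin.ext h
          rw [this]; exact h4
    by_cases hA : CC J (fun b => l (π b)) τ (j + 1) z.1 z.2 <;>
    by_cases hB : z.1 (l (π ⟨j + 1, by omega⟩)) = z.2 (l (π ⟨j + 1, by omega⟩)) <;>
    simp [hiff, hA, hB]

lemma diag {p lam m n : ℕ} [NeZero p] (hp : p.Prime) (hlam : 0 < lam) (hdvd : p ∣ lam)
    (f : (Fin m → Fin p) → ZMod lam) (r : Fin (n + 1) → Fin m) (hr : Function.Injective r)
    (T T' : Fin (n + 1) → Fin p) :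
    ∑ x : Fin m → Fin p, ee lam (BB f r T T' x x) = if T = T' then (p : ℂ) ^ m else 0 := by
  haveI : NeZero lam := ⟨hlam.ne'⟩
  split_ifs with h
  · subst h
    simp [BB, ee_zero]
  · obtain ⟨i, hi⟩ := Function.ne_iff.mp h
    apply avg (p := p) _ (fun s => sh (r i) s)
    intro x
    have hB : ∀ s : Fin p, BB f r T T' (sh (r i) s x) (sh (r i) s x) = BB f r T T' x x +
      ((lam / p : ℕ) : ZMod lam) * (1 : ℕ) * (s : ℕ) * ((T i : ℕ) - (T' i : ℕ)) := by
      intro s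
      simp only [BB, sub_self, zero_add]
      rw [← Finset.sum_sub_distrib, ← Finset.sum_sub_distrib]
      have key : ∀ b, ((lam / p : ℕ) : ZMod lam) * (T b : ℕ) * (sh (r i) s x (r b) : ℕ)
          - ((lam / p : ℕ) : ZMod lam) * (T' b : ℕ) * (sh (r i) s x (r b) : ℕ)
          = (((lam / p : ℕ) : ZMod lam) * (T b : ℕ) * (x (r b) : ℕ)
          - ((lam / p : ℕ) : ZMod lam) * (T' b : ℕ) * (x (r b) : ℕ))
          + if b = i then ((lam / p : ℕ) : ZMod lam) * (1 : ℕ) * (s : ℕ) *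
            ((T i : ℕ) - (T' i : ℕ)) else 0 := by
        intro b
        by_cases hb : b = i
        · subst hb
          rw [if_pos rfl, sh_same]
          have := h_val hdvd (x (r b)) s
          push_cast
          linear_combination ((T b : ℕ) - (T' b : ℕ) : ZMod lam) * this
        · rw [if_neg hb, sh_ne _ _ _ _ (fun h => hb (hr h)), add_zero]
      rw [Finset.sum_congr rfl (fun b _ => key b), Finset.sum_add_distrib]
      simp
    simp only [hB, ee_add]
    rw [← Finset.mul_sum, orth hp hlam hdvd 1 (by simpa using hp.one_lt.ne'), if_neg hi, mul_zero]

theorem stmt2 {p lam m n : ℕ} [NeZero p] (hp : p.Prime) (hodd : Odd p)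
    (hlam : 0 < lam) (hdvd : p ∣ lam) (hm : 1 ≤ m) (hn : n ≤ m - 1)
    (f : (Fin m → Fin p) → ZMod lam)
    (J : Fin n → Fin m) (hJ : Function.Injective J)
    (l : Fin (m - n) → Fin m) (hl : Function.Injective l)
    (hcompl : ∀ i : Fin m, (∃ b, l b = i) ↔ ¬∃ a, J a = i)
    (π : Equiv.Perm (Fin (m - n)))
    (hHPC : hamiltonianPathCond p lam m n f J l π)
    (k : ℕ) (hk1 : 1 ≤ k) (hk2 : k ≤ p - 1)
    (t t' : ℕ) (ht : t < p ^ (n + 1)) (ht' : t' < p ^ (n + 1))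
    (τ : ℤ) (hτ : |τ| < (p : ℤ) ^ m) :
    (∑ d ∈ Finset.range (p ^ (n + 1)),
        corr (p ^ m)
          (psi p lam m (codeword p lam m n f J
            (l (π ⟨0, by omega⟩)) (l (π ⟨m - n - 1, by omega⟩)) k d t))
          (psi p lam m (codeword p lam m n f J
            (l (π ⟨0, by omega⟩)) (l (π ⟨m - n - 1, by omega⟩)) k d t'))
          τ)
      = if τ = 0 ∧ t = t' then ((p : ℂ) ^ (m + n + 1)) else 0 := by
  classical
  haveI : NeZero lam := ⟨hlam.ne'⟩
  have hk : ¬ p ∣ k := fun h => by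
    have := Nat.le_of_dvd (by omega) h
    have := hp.pos
    omega
  set P : Fin (m - n) → Fin m := fun b => l (π b) with hPdef
  have hP : Function.Injective P := hl.comp π.injective
  have hPJ : ∀ b i, P b ≠ J i := fun b i h => (hcompl (P b)).mp ⟨_, rfl⟩ ⟨i, h.symm⟩
  set l0 : Fin m := l (π ⟨0, by omega⟩) with hl0
  set lN : Fin m := l (π ⟨m - n - 1, by omega⟩) with hlN
  set q : Fin (n + 1) → Fin m := Fin.snoc J l0 with hq
  set r : Fin (n + 1) → Fin m := Fin.snoc J lN with hrdef
  have hrP : ∀ j (hj : j + 1 < m - n), ∀ i, r i ≠ l (π ⟨j, by omega⟩) := by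
    intro j hj i
    refine Fin.lastCases ?_ (fun i => ?_) i
    · simp only [hrdef, Fin.snoc_last]
      intro h
      have := hP (a₁ := ⟨m - n - 1, by omega⟩) (a₂ := ⟨j, by omega⟩) h
      simp at this
      omega
    · simp only [hrdef, Fin.snoc_castSucc]
      exact (hPJ _ _).symm
  have hrinj : Function.Injective r := by
    intro i i'
    refine Fin.lastCases ?_ (fun i => ?_) i <;> refine Fin.lastCases ?_ (fun i' => ?_) i'
    · simp
    · simp only [hrdef, Fin.snoc_last, Fin.snoc_castSucc]
      intro h
      exact absurd h (hPJ _ _)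
    · simp only [hrdef, Fin.snoc_last, Fin.snoc_castSucc]
      intro h
      exact absurd h.symm (hPJ _ _)
    · simp only [hrdef, Fin.snoc_castSucc]
      intro h
      rw [hJ h]
  set T := digitVec p (n + 1) t with hT
  set T' := digitVec p (n + 1) t' with hT'
  have hTT : T = T' ↔ t = t' := by
    constructor
    · intro h
      have h1 := dE_apply p (n + 1) ⟨t, ht⟩
      have h2 := dE_apply p (n + 1) ⟨t', ht'⟩
      have h3 : dE p (n + 1) ⟨t, ht⟩ = dE p (n + 1) ⟨t', ht'⟩ := by
        rw [h1, h2]; exact h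
      simpa using (dE p (n + 1)).injective h3
    · intro h
      rw [hT, hT', h]
  have hcw : ∀ (d : ℕ) (x y : Fin m → Fin p),
      codeword p lam m n f J l0 lN k d t x - codeword p lam m n f J l0 lN k d t' y
      = BB f r T T' x y + ∑ i, ((lam / p : ℕ) : ZMod lam) * k * (digitVec p (n + 1) d i : ℕ) *
        ((x (q i) : ℕ) - (y (q i) : ℕ)) := by
    intro d x y
    simp only [codeword, BB, Fin.sum_univ_castSucc, hq, hrdef, Fin.snoc_castSucc, Fin.snoc_last,
      hT, hT', mul_sub, Finset.sum_sub_distrib]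
    push_cast
    simp only [mul_add, Finset.mul_sum, mul_comm, mul_left_comm, mul_assoc]
    ring
  have hS : (∑ d ∈ Finset.range (p ^ (n + 1)),
        corr (p ^ m) (psi p lam m (codeword p lam m n f J l0 lN k d t))
          (psi p lam m (codeword p lam m n f J l0 lN k d t')) τ)
      = (p : ℂ) ^ (n + 1) * ∑ z : (Fin m → Fin p) × (Fin m → Fin p),
        if CC J P τ 1 z.1 z.2 then ee lam (BB f r T T' z.1 z.2) else 0 := by
    simp only [corr_eq]
    rw [Finset.sum_comm, Fintype.sum_prod_type, Finset.mul_sum]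
    refine Finset.sum_congr rfl fun x _ => ?_
    rw [Finset.sum_comm, Finset.mul_sum]
    refine Finset.sum_congr rfl fun y _ => ?_
    simp only [hcw]
    have hiff : CC J P τ 1 x y ↔ (num p m x : ℤ) = num p m y + τ ∧ ∀ i, x (q i) = y (q i) := by
      simp only [CC, Fin.forall_fin_succ', hq, Fin.snoc_castSucc, Fin.snoc_last]
      constructor
      · rintro ⟨h1, h2, h3⟩
        exact ⟨h1, h2, h3 ⟨0, by omega⟩ (by simp)⟩
      · rintro ⟨h1, h2, h3⟩
        refine ⟨h1, h2, fun b hb => ?_⟩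
        have : b = ⟨0, by omega⟩ := Fin.ext (by simpa using hb)
        rw [this]; exact h3
    by_cases h1 : (num p m x : ℤ) = num p m y + τ
    · simp only [if_pos h1, ee_add]
      rw [← Finset.mul_sum, sum_digit p (n + 1) (fun _ D => ee lam (∑ i,
        ((lam / p : ℕ) : ZMod lam) * k * (D i : ℕ) * ((x (q i) : ℕ) - (y (q i) : ℕ)))),
        orth_pi hp hlam hdvd k hk (n + 1) (fun i => x (q i)) (fun i => y (q i))]
      simp only [hiff, h1, true_and]
      split_ifs <;> ring
    · simp [hiff, h1]
  rw [hS, step_all hp hlam hdvd f J l hl hcompl π hHPC r T T' τ hrP (m - n - 1) (by omega)]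
  have hfin : ∀ x y : Fin m → Fin p,
      CC J (fun b => l (π b)) τ (m - n - 1 + 1) x y ↔ τ = 0 ∧ x = y := by
    intro x y
    constructor
    · rintro ⟨h1, h2, h3⟩
      have hxy : x = y := by
        funext i
        by_cases hi : ∃ a, J a = i
        · obtain ⟨a, rfl⟩ := hi
          exact h2 a
        · obtain ⟨b, rfl⟩ := (hcompl i).mpr hi
          have := h3 (π.symm b) (by omega)
          simpa using this
      subst hxy
      exact ⟨by linarith, rfl⟩
    · rintro ⟨h1, rfl⟩
      exact ⟨by simp [h1], fun _ => rfl, fun _ _ => rfl⟩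
  simp only [hfin]
  by_cases hτ0 : τ = 0
  · simp only [hτ0, true_and, Fintype.sum_prod_type, Finset.sum_ite_eq, Finset.mem_univ, if_true]
    rw [diag hp hlam hdvd f r hrinj T T']
    simp only [hTT]
    split_ifs
    · rw [← pow_add]; congr 1; omega
    · simp
  · simp [hτ0]
end QCCS
end
end

section
/- Let m ≥ 1 and 0 ≤ n ≤ m-1 be integers, and set K = 2·3^{n+1}, M = 3^{n+1}, L = 3^m, θ = 3^m. Then the Welch optimality factor ρ = θ / (M·L·√((K/M − 1)/(K(2L − 1) − 1))) satisfies ρ = √(4·3^{m-n-1} − 2/3^{n+1} − 1/3^{2(n+1)}). In particular, when n = m-1, one has 1 < ρ ≤ 2. -/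
theorem stmt5 (m n : ℕ) (hm : 1 ≤ m) (hn : n ≤ m - 1) :
    let K : ℝ := 2 * 3 ^ (n + 1)
    let M : ℝ := 3 ^ (n + 1)
    let L : ℝ := 3 ^ m
    let θ : ℝ := 3 ^ m
    let ρ : ℝ := θ / (M * L * Real.sqrt ((K / M - 1) / (K * (2 * L - 1) - 1)))
    ρ = Real.sqrt (4 * 3 ^ (m - n - 1) - 2 / 3 ^ (n + 1) - 1 / 3 ^ (2 * (n + 1)))
      ∧ (n = m - 1 → 1 < ρ ∧ ρ ≤ 2) := by
  intro K M L θ ρ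
  obtain ⟨d, rfl⟩ : ∃ d, m = n + 1 + d := ⟨m - (n + 1), by omega⟩
  have hd : n + 1 + d - n - 1 = d := by omega
  have hM : (3 : ℝ) ≤ M := by
    have : (1 : ℝ) ≤ 3 ^ n := one_le_pow₀ (by norm_num)
    simp only [M, pow_succ]; linarith
  have hM0 : M ≠ 0 := by positivity
  have hE : (1 : ℝ) ≤ 3 ^ d := one_le_pow₀ (by norm_num)
  have hL : L = M * 3 ^ d := by simp only [L, M, pow_add]
  have hL3 : (3 : ℝ) ≤ L := by rw [hL]; nlinarith
  have hKM : K / M - 1 = 1 := by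
    have : K = 2 * M := rfl
    rw [this]; field_simp; norm_num
  have hD : 0 < K * (2 * L - 1) - 1 := by
    have : K = 2 * M := rfl
    rw [this]; nlinarith
  have h1 : ρ = Real.sqrt (4 * 3 ^ d - 2 / M - 1 / M ^ 2) := by
    have e : 4 * 3 ^ d - 2 / M - 1 / M ^ 2 = (K * (2 * L - 1) - 1) / M ^ 2 := by
      have : K = 2 * M := rfl
      rw [this, hL]; field_simp; ring
    rw [e, Real.sqrt_div hD.le, Real.sqrt_sq (by linarith)]
    have hs : Real.sqrt (K * (2 * L - 1) - 1) ≠ 0 := (Real.sqrt_pos.2 hD).ne'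
    have hL0 : L ≠ 0 := by linarith
    change L / (M * L * Real.sqrt ((K / M - 1) / (K * (2 * L - 1) - 1))) = _
    rw [hKM, Real.sqrt_div zero_le_one, Real.sqrt_one]
    field_simp
  have hM2 : (3 : ℝ) ^ (2 * (n + 1)) = M ^ 2 := by
    simp only [M]; rw [← pow_mul, mul_comm]
  refine ⟨by rw [hd, hM2]; exact h1, fun h => ?_⟩
  obtain rfl : d = 0 := by omega
  have a1 : 2 / M ≤ 2 / 3 := by gcongr
  have a2 : 1 / M ^ 2 ≤ 1 / 3 ^ 2 := by gcongr
  have a3 : 0 < 2 / M := by positivity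
  have a4 : 0 < 1 / M ^ 2 := by positivity
  rw [h1]
  constructor
  · apply Real.lt_sqrt_of_sq_lt
    norm_num at *; linarith
  · apply Real.sqrt_le_iff.2
    refine ⟨by norm_num, ?_⟩
    rw [pow_zero]; linarith
end

section
/- For a prime p > 3, let m ≥ 1, n = m-1, and set K = p^{n+1}(p-1), M = p^{n+1}, L = p^m, θ = p^m. Then the optimality factor ρ(p) = θ / √(M·L·(1 − 2√(M/(3K)))) equals 1/√(1 − 2√(1/(3(p−1)))), and ρ(p) → 1 as p → ∞. -/
theorem stmt6 :
    (∀ p m n : ℕ, p.Prime → 3 < p → 1 ≤ m → n = m - 1 →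
      (p : ℝ) ^ m /
          Real.sqrt ((p : ℝ) ^ (n + 1) * (p : ℝ) ^ m *
            (1 - 2 * Real.sqrt
              ((p : ℝ) ^ (n + 1) / (3 * ((p : ℝ) ^ (n + 1) * ((p : ℝ) - 1))))))
        = 1 / Real.sqrt (1 - 2 * Real.sqrt (1 / (3 * ((p : ℝ) - 1)))))
    ∧ Filter.Tendsto
        (fun p : ℕ => 1 / Real.sqrt (1 - 2 * Real.sqrt (1 / (3 * ((p : ℝ) - 1)))))
        Filter.atTop (nhds 1) := by
  constructor
  · intro p m n hp h3 hm hn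
    have hnm : n + 1 = m := by omega
    rw [hnm]
    have hp3 : (3 : ℝ) < p := by exact_mod_cast h3
    have hp0 : (0 : ℝ) < p := by linarith
    have hx : (0 : ℝ) < (p : ℝ) ^ m := by positivity
    have hq : (p : ℝ) - 1 ≠ 0 := by linarith
    have h1 : (p : ℝ) ^ m / (3 * ((p : ℝ) ^ m * ((p : ℝ) - 1))) = 1 / (3 * ((p : ℝ) - 1)) := by
      field_simp
    rw [h1, Real.sqrt_mul (by positivity), Real.sqrt_mul_self hx.le, ← div_div, div_self hx.ne']
  · have h1 : Filter.Tendsto (fun p : ℕ => 3 * ((p : ℝ) - 1)) Filter.atTop Filter.atTop :=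
      (Filter.tendsto_atTop_add_const_right _ (-1 : ℝ)
        tendsto_natCast_atTop_atTop).const_mul_atTop (by norm_num)
    have h2 : Filter.Tendsto (fun p : ℕ => 1 / (3 * ((p : ℝ) - 1))) Filter.atTop (nhds 0) :=
      h1.const_div_atTop 1
    have h3 : Filter.Tendsto (fun p : ℕ => 1 - 2 * Real.sqrt (1 / (3 * ((p : ℝ) - 1))))
        Filter.atTop (nhds (1 - 2 * Real.sqrt 0)) := (h2.sqrt.const_mul 2).const_sub 1
    have h4 := h3.sqrt
    simp only [Real.sqrt_zero, mul_zero, sub_zero, Real.sqrt_one] at h4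
    have h5 := (tendsto_const_nhds (x := (1 : ℝ))).div h4 one_ne_zero
    rwa [div_one] at h5
end

section
/- Let p be an odd prime, w ≥ 0 an integer, and k1 ≠ k2 ∈ {1,...,p-1}. Let S = {(e1,e2) : e1, e2 ∈ {0,...,p-1}^w, k1·e1 ≡ k2·e2 (mod p) componentwise}, and define Λ : S → ℤ by Λ(e1,e2) = Σ_{α=0}^{w-1} (e_{2,α} − e_{1,α}) p^{w-1-α}, with the digits regarded as integers. Then Λ is injective on S. -/
namespace QCCS

/-- `Λ(e1,e2) = Σ_{a=0}^{w-1} (e_{2,a} - e_{1,a}) p^{w-1-a}`, digits regarded as integers. -/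
def Dval (p w : ℕ) (e1 e2 : Fin w → Fin p) : ℤ :=
  ∑ a : Fin w, (((e2 a : ℕ) : ℤ) - ((e1 a : ℕ) : ℤ)) * (p : ℤ) ^ (w - 1 - (a : ℕ))

/-- Membership in the set `S`: `k1·e1 ≡ k2·e2 (mod p)` componentwise. -/
def inS (p w k1 k2 : ℕ) (e : (Fin w → Fin p) × (Fin w → Fin p)) : Prop :=
  ∀ a, ((k1 * (e.1 a : ℕ) : ℕ) : ZMod p) = ((k2 * (e.2 a : ℕ) : ℕ) : ZMod p)

theorem Dval_succ (p w : ℕ) (f g : Fin (w + 1) → Fin p) :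
    Dval p (w + 1) f g = p * Dval p w (fun a => f a.castSucc) (fun a => g a.castSucc)
      + (((g (Fin.last w) : ℕ) : ℤ) - ((f (Fin.last w) : ℕ) : ℤ)) := by
  unfold Dval
  rw [Fin.sum_univ_castSucc, Finset.mul_sum]
  congr 1
  · apply Finset.sum_congr rfl
    intro a _
    have h : w + 1 - 1 - (a.castSucc : ℕ) = (w - 1 - (a : ℕ)) + 1 := by
      have := a.isLt
      simp only [Fin.val_castSucc]
      omega
    rw [h, pow_succ]
    ring
  · simp

theorem cast_inj_fin {p : ℕ} (x y : Fin p) (h : ((x : ℕ) : ZMod p) = ((y : ℕ) : ZMod p)) :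
    x = y := by
  rw [ZMod.natCast_eq_natCast_iff'] at h
  rw [Nat.mod_eq_of_lt x.isLt, Nat.mod_eq_of_lt y.isLt] at h
  exact Fin.ext h

theorem inj_aux {p : ℕ} (hp : p.Prime) (k1 k2 : ℕ)
    (hk : (k1 : ZMod p) ≠ (k2 : ZMod p)) (w : ℕ) :
    ∀ f g f' g' : Fin w → Fin p, inS p w k1 k2 (f, g) → inS p w k1 k2 (f', g') →
      Dval p w f g = Dval p w f' g' → ∀ a, f a = f' a ∧ g a = g' a := by
  haveI : Fact p.Prime := ⟨hp⟩
  induction w with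
  | zero => intro f g f' g' _ _ _ a; exact a.elim0
  | succ w ih =>
    intro f g f' g' h h' hD
    rw [Dval_succ, Dval_succ] at hD
    have hl := h (Fin.last w)
    have hl' := h' (Fin.last w)
    have hm := congrArg (Int.cast : ℤ → ZMod p) hD
    push_cast at hl hl' hm
    simp only [CharP.cast_eq_zero, zero_mul, zero_add] at hm
    have h1 : f (Fin.last w) = f' (Fin.last w) := by
      apply cast_inj_fin
      apply mul_left_cancel₀ (sub_ne_zero.mpr hk)
      linear_combination hl - hl' + (k2 : ZMod p) * hm
    have h2 : g (Fin.last w) = g' (Fin.last w) := by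
      apply cast_inj_fin
      rw [h1] at hm
      linear_combination hm
    rw [h1, h2] at hD
    have hp0 : (p : ℤ) ≠ 0 := by exact_mod_cast hp.ne_zero
    have hD' := mul_left_cancel₀ hp0 (add_right_cancel hD)
    have := ih _ _ _ _ (fun a => h a.castSucc) (fun a => h' a.castSucc) hD'
    intro a
    refine Fin.lastCases ⟨h1, h2⟩ (fun i => this i) a

theorem stmt8 {p : ℕ} [NeZero p] (hp : p.Prime) (hodd : Odd p) (w : ℕ)
    (k1 k2 : ℕ) (hk11 : 1 ≤ k1) (hk12 : k1 ≤ p - 1) (hk21 : 1 ≤ k2) (hk22 : k2 ≤ p - 1)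
    (hk : k1 ≠ k2)
    (e e' : (Fin w → Fin p) × (Fin w → Fin p))
    (he : inS p w k1 k2 e) (he' : inS p w k1 k2 e')
    (hlam : Dval p w e.1 e.2 = Dval p w e'.1 e'.2) :
    e = e' := by
  have hp2 := hp.two_le
  have hkne : (k1 : ZMod p) ≠ (k2 : ZMod p) := by
    intro h
    rw [ZMod.natCast_eq_natCast_iff', Nat.mod_eq_of_lt (by omega),
      Nat.mod_eq_of_lt (by omega)] at h
    exact hk h
  have hall := inj_aux hp k1 k2 hkne w e.1 e.2 e'.1 e'.2 he he' hlam
  exact Prod.ext (funext fun a => (hall a).1) (funext fun a => (hall a).2)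
end QCCS
end

section
/- Let p be an odd prime, w ≥ 0 an integer, and k1 ≠ k2 ∈ {1,...,p-1}. Let S = {(e1,e2) : e1, e2 ∈ {0,...,p-1}^w, k1·e1 ≡ k2·e2 (mod p) componentwise}, and Λ(e1,e2) = Σ_{α=0}^{w-1} (e_{2,α} − e_{1,α}) p^{w-1-α}. For (e1,e2) ∈ S, define the complemented pair (ē1, ē2) componentwise by ē_{i,α} = p − e_{i,α} if e_{i,α} ≠ 0 and ē_{i,α} = 0 if e_{i,α} = 0 (for i = 1,2 and α = 0,...,w-1). Then (ē1, ē2) ∈ S and Λ(ē1, ē2) = −Λ(e1, e2). -/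
namespace QCCS

/-- The componentwise complement: `ē_a = p - e_a` if `e_a ≠ 0`, and `ē_a = 0` if `e_a = 0`. -/
def complVec (p w : ℕ) [NeZero p] (e : Fin w → Fin p) : Fin w → Fin p :=
  fun a =>
    if h : (e a : ℕ) = 0 then ⟨0, Nat.pos_of_ne_zero (NeZero.ne p)⟩
    else ⟨p - (e a : ℕ), by have := (e a).isLt; omega⟩

theorem complVec_int (p w : ℕ) [NeZero p] (e : Fin w → Fin p) (a : Fin w) :
    ((complVec p w e a : ℕ) : ℤ) = if (e a : ℕ) = 0 then 0 else (p : ℤ) - ((e a : ℕ) : ℤ) := by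
  have := (e a).isLt
  unfold complVec
  split_ifs with h
  · simp
  · simp only
    omega

theorem complVec_zmod (p w : ℕ) [NeZero p] (e : Fin w → Fin p) (a : Fin w) :
    ((complVec p w e a : ℕ) : ZMod p) = - ((e a : ℕ) : ZMod p) := by
  have h := congrArg (Int.cast : ℤ → ZMod p) (complVec_int p w e a)
  split_ifs at h with h0
  · rw [h0]; simpa using h
  · simpa using h

theorem zero_of_zero {p : ℕ} (hp : p.Prime) {k1 k2 x y : ℕ} (hk21 : 1 ≤ k2) (hk22 : k2 ≤ p - 1)
    (hy : y < p) (h : ((k1 * x : ℕ) : ZMod p) = ((k2 * y : ℕ) : ZMod p)) (hx : x = 0) :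
    y = 0 := by
  subst hx
  have h2 : p ∣ k2 * y := by
    rw [← ZMod.natCast_eq_zero_iff, ← h]; simp
  rcases hp.dvd_mul.1 h2 with h3 | h3
  · have := Nat.le_of_dvd hk21 h3
    have := hp.pos
    omega
  · exact Nat.eq_zero_of_dvd_of_lt h3 hy

theorem stmt10 {p : ℕ} [NeZero p] (hp : p.Prime) (hodd : Odd p) (w : ℕ)
    (k1 k2 : ℕ) (hk11 : 1 ≤ k1) (hk12 : k1 ≤ p - 1) (hk21 : 1 ≤ k2) (hk22 : k2 ≤ p - 1)
    (hk : k1 ≠ k2)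
    (e : (Fin w → Fin p) × (Fin w → Fin p)) (he : inS p w k1 k2 e) :
    inS p w k1 k2 (complVec p w e.1, complVec p w e.2)
      ∧ Dval p w (complVec p w e.1) (complVec p w e.2) = - Dval p w e.1 e.2 := by
  constructor
  · intro a
    have h := he a
    push_cast at h ⊢
    rw [complVec_zmod, complVec_zmod, mul_neg, mul_neg, h]
  · unfold Dval
    rw [← Finset.sum_neg_distrib]
    refine Finset.sum_congr rfl fun a _ => ?_
    have h1 := zero_of_zero hp hk21 hk22 (e.2 a).isLt (he a)
    have h2 := zero_of_zero hp hk11 hk12 (e.1 a).isLt (he a).symm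
    rw [complVec_int, complVec_int]
    by_cases h : (e.1 a : ℕ) = 0
    · simp [h, h1 h]
    · have h' : (e.2 a : ℕ) ≠ 0 := fun q => h (h2 q)
      rw [if_neg h, if_neg h']
      ring
end QCCS
end

section
/- Let p be an odd prime, w ≥ 0 an integer, and k1 ≠ k2 ∈ {1,...,p-1}. Let S = {(e1,e2) : e1, e2 ∈ {0,...,p-1}^w, k1·e1 ≡ k2·e2 (mod p) componentwise}, Λ(e1,e2) = Σ_{α=0}^{w-1} (e_{2,α} − e_{1,α}) p^{w-1-α}, S' = {(e1,e2) ∈ S : Λ(e1,e2) ≥ 0}, and S'' = {(e1,e2) ∈ S : Λ(e1,e2) ≤ 0}. Then S = S' ∪ S'', S' ∩ S'' = {((0,...,0),(0,...,0))}, and |S'| = |S''| = (p^w + 1)/2. -/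
namespace QCCS

theorem digits_zero {p : ℕ} (hp : 0 < p) : ∀ (w : ℕ) (d : Fin w → ℤ), (∀ a, |d a| < p) →
    ∑ a : Fin w, d a * (p : ℤ) ^ (w - 1 - (a : ℕ)) = 0 → ∀ a, d a = 0 := by
  intro w
  induction w with
  | zero => intro d _ _ a; exact a.elim0
  | succ n ih =>
    intro d hd hs
    rw [Fin.sum_univ_castSucc] at hs
    have h1 : ∀ a : Fin n, d a.castSucc * (p : ℤ) ^ (n + 1 - 1 - ((a.castSucc : Fin (n+1)) : ℕ))
        = (p : ℤ) * (d a.castSucc * (p : ℤ) ^ (n - 1 - (a : ℕ))) := by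
      intro a
      have : n + 1 - 1 - ((a.castSucc : Fin (n+1)) : ℕ) = (n - 1 - (a : ℕ)) + 1 := by
        have := a.2
        simp only [Fin.val_castSucc]
        omega
      rw [this, pow_succ]
      ring
    rw [Finset.sum_congr rfl (fun a _ => h1 a), ← Finset.mul_sum] at hs
    have h2 : n + 1 - 1 - ((Fin.last n : Fin (n+1)) : ℕ) = 0 := by simp
    rw [h2, pow_zero, mul_one] at hs
    have hl : d (Fin.last n) = 0 := by
      apply Int.eq_zero_of_abs_lt_dvd (m := (p : ℤ)) _ (hd _)
      exact ⟨-(∑ a : Fin n, d a.castSucc * (p : ℤ) ^ (n - 1 - (a : ℕ))), by linarith⟩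
    rw [hl, add_zero] at hs
    have hs' := (mul_eq_zero.mp hs).resolve_left (by exact_mod_cast hp.ne')
    have h3 := ih (fun a => d a.castSucc) (fun a => hd _) hs'
    intro a
    induction a using Fin.lastCases with
    | last => exact hl
    | cast i => exact h3 i

/-- Negation of a digit modulo `p`. -/
def ng {p : ℕ} (x : Fin p) : Fin p := ⟨(p - x) % p, Nat.mod_lt _ (Nat.zero_lt_of_lt x.2)⟩

theorem ng_val {p : ℕ} (x : Fin p) :
    ((x : ℕ) = 0 ∧ (ng x : ℕ) = 0) ∨ ((x : ℕ) ≠ 0 ∧ (ng x : ℕ) = p - x) := by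
  have hx := x.2
  by_cases h : (x : ℕ) = 0
  · left; simp [ng, h]
  · right; exact ⟨h, Nat.mod_eq_of_lt (by omega)⟩

theorem ng_ng {p : ℕ} (x : Fin p) : ng (ng x) = x := by
  have hx := x.2
  have h1 := ng_val x
  have h2 := ng_val (ng x)
  apply Fin.ext
  omega

theorem ng_cast {p : ℕ} (x : Fin p) : ((ng x : ℕ) : ZMod p) = -((x : ℕ) : ZMod p) := by
  simp [ng, Nat.cast_sub x.2.le]

theorem stmt11 {p : ℕ} [NeZero p] (hp : p.Prime) (hodd : Odd p) (w : ℕ)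
    (k1 k2 : ℕ) (hk11 : 1 ≤ k1) (hk12 : k1 ≤ p - 1) (hk21 : 1 ≤ k2) (hk22 : k2 ≤ p - 1)
    (hk : k1 ≠ k2) :
    let S : Finset ((Fin w → Fin p) × (Fin w → Fin p)) :=
      Finset.filter
        (fun e => ∀ a, ((k1 * (e.1 a : ℕ) : ℕ) : ZMod p) = ((k2 * (e.2 a : ℕ) : ℕ) : ZMod p))
        Finset.univ
    let S' : Finset ((Fin w → Fin p) × (Fin w → Fin p)) :=
      Finset.filter (fun e => 0 ≤ Dval p w e.1 e.2) S
    let S'' : Finset ((Fin w → Fin p) × (Fin w → Fin p)) :=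
      Finset.filter (fun e => Dval p w e.1 e.2 ≤ 0) S
    S = S' ∪ S''
      ∧ S' ∩ S'' = {((fun _ => 0), (fun _ => 0))}
      ∧ S'.card = (p ^ w + 1) / 2 ∧ S''.card = (p ^ w + 1) / 2 := by
  intro S S' S''
  haveI : Fact p.Prime := ⟨hp⟩
  have hk1 : (k1 : ZMod p) ≠ 0 := by
    rw [Ne, ZMod.natCast_eq_zero_iff]
    exact fun h => by have := Nat.le_of_dvd (by omega) h; omega
  have hk2 : (k2 : ZMod p) ≠ 0 := by
    rw [Ne, ZMod.natCast_eq_zero_iff]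
    exact fun h => by have := Nat.le_of_dvd (by omega) h; omega
  have hkk : (k1 : ZMod p) ≠ k2 := by
    intro h
    rw [ZMod.natCast_eq_natCast_iff'] at h
    rw [Nat.mod_eq_of_lt (by omega), Nat.mod_eq_of_lt (by omega)] at h
    exact hk h
  have hinj : ∀ x y : Fin p, ((x : ℕ) : ZMod p) = ((y : ℕ) : ZMod p) → x = y := by
    intro x y h
    rw [ZMod.natCast_eq_natCast_iff', Nat.mod_eq_of_lt x.2, Nat.mod_eq_of_lt y.2] at h
    exact Fin.ext h
  have hz0 : (((0 : Fin p) : ℕ) : ZMod p) = 0 := by simp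
  have hS : ∀ e, e ∈ S ↔ ∀ a, (k1 : ZMod p) * ((e.1 a : ℕ) : ZMod p)
      = (k2 : ZMod p) * ((e.2 a : ℕ) : ZMod p) := by
    intro e; simp [S]
  have hU : S = S' ∪ S'' := by
    ext e
    simp only [S', S'', Finset.mem_union, Finset.mem_filter]
    have := le_total 0 (Dval p w e.1 e.2)
    tauto
  have hI : S' ∩ S'' = {((fun _ => 0), (fun _ => 0))} := by
    ext e
    simp only [S', S'', Finset.mem_inter, Finset.mem_filter, Finset.mem_singleton]
    constructor
    · rintro ⟨⟨he, h1⟩, _, h2⟩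
      have h0 := le_antisymm h2 h1
      have hd := digits_zero hp.pos w
        (fun a => (((e.2 a : ℕ) : ℤ) - ((e.1 a : ℕ) : ℤ))) (by
          intro a
          have := (e.1 a).2
          have := (e.2 a).2
          rw [abs_lt]; constructor <;> omega) h0
      rw [hS] at he
      have h3 : ∀ a, e.1 a = 0 ∧ e.2 a = 0 := by
        intro a
        have h4 := hd a
        have h5 : e.2 a = e.1 a := Fin.ext (by omega)
        have h6 := he a
        rw [h5] at h6
        have h7 : ((e.1 a : ℕ) : ZMod p) = 0 := by
          by_contra hne
          exact hkk (mul_right_cancel₀ hne h6)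
        have h8 := hinj (e.1 a) 0 (h7.trans hz0.symm)
        exact ⟨h8, h5.trans h8⟩
      exact Prod.ext (funext fun a => (h3 a).1) (funext fun a => (h3 a).2)
    · rintro rfl
      have : (((fun _ => 0), (fun _ => 0)) : (Fin w → Fin p) × (Fin w → Fin p)) ∈ S := by
        rw [hS]; intro a; simp
      simp [this, Dval]
  have hcS : S.card = p ^ w := by
    have : S.card = (Finset.univ : Finset (Fin w → Fin p)).card := by
      apply Finset.card_bij (fun e _ => e.1)
      · intros; exact Finset.mem_univ _
      · intro e he f hf hef
        rw [hS] at he hf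
        refine Prod.ext hef (funext fun a => hinj _ _ ?_)
        apply mul_left_cancel₀ hk2
        rw [← he a, ← hf a, hef]
      · intro e1 _
        refine ⟨(e1, fun a => ⟨((k2 : ZMod p)⁻¹ * (k1 * ((e1 a : ℕ) : ZMod p))).val,
          ZMod.val_lt _⟩), ?_, rfl⟩
        rw [hS]
        intro a
        simp only [ZMod.natCast_zmod_val]
        rw [mul_inv_cancel_left₀ hk2]
    rw [this]; simp
  have hngS : ∀ e ∈ S, ((fun a => ng (e.1 a)), (fun a => ng (e.2 a))) ∈ S := by
    intro e he
    rw [hS] at he ⊢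
    intro a
    simp only [ng_cast, mul_neg, he a]
  have hngD : ∀ e ∈ S, Dval p w (fun a => ng (e.1 a)) (fun a => ng (e.2 a))
      = - Dval p w e.1 e.2 := by
    intro e he
    rw [hS] at he
    unfold Dval
    rw [← Finset.sum_neg_distrib]
    apply Finset.sum_congr rfl
    intro a _
    rw [← neg_mul]
    congr 1
    have hz : (e.1 a : ℕ) = 0 ↔ (e.2 a : ℕ) = 0 := by
      have h := he a
      constructor
      · intro h0
        rw [h0, Nat.cast_zero, mul_zero] at h
        have := (mul_eq_zero.mp h.symm).resolve_left hk2
        rw [hinj _ 0 (this.trans hz0.symm)]; simp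
      · intro h0
        rw [h0, Nat.cast_zero, mul_zero] at h
        have := (mul_eq_zero.mp h).resolve_left hk1
        rw [hinj _ 0 (this.trans hz0.symm)]; simp
    beta_reduce
    have h1 := ng_val (e.1 a)
    have h2 := ng_val (e.2 a)
    have := (e.1 a).2
    have := (e.2 a).2
    omega
  have hc : S'.card = S''.card := by
    apply Finset.card_nbij' (fun e => ((fun a => ng (e.1 a)), (fun a => ng (e.2 a))))
      (fun e => ((fun a => ng (e.1 a)), (fun a => ng (e.2 a))))
    · intro e he
      have he := Finset.mem_filter.mp (Finset.mem_coe.mp he)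
      refine Finset.mem_coe.mpr (Finset.mem_filter.mpr ⟨hngS e he.1, ?_⟩)
      have := hngD e he.1
      have := he.2
      simp only at *
      omega
    · intro e he
      have he := Finset.mem_filter.mp (Finset.mem_coe.mp he)
      refine Finset.mem_coe.mpr (Finset.mem_filter.mpr ⟨hngS e he.1, ?_⟩)
      have := hngD e he.1
      have := he.2
      simp only at *
      omega
    · intro e _; simp [ng_ng]
    · intro e _; simp [ng_ng]
  have hsum := Finset.card_union_add_card_inter S' S''
  rw [← hU, hI, hcS, Finset.card_singleton] at hsum
  exact ⟨hU, hI, by omega, by omega⟩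
end QCCS
end

section
/- Let p be a prime, m ≥ 1, and 0 ≤ w ≤ m-1. Let e1, e2 ∈ {0,...,p-1}^w and set D = Σ_{α=0}^{w-1} (e_{2,α} − e_{1,α}) p^{w-1-α} (an integer). For an integer 0 ≤ τ ≤ p^m − 1, define B_τ(e1,e2) = {(γ,δ) : 0 ≤ γ ≤ p^m − τ − 1, δ = γ + τ, γ_α = e_{1,α} and δ_α = e_{2,α} for α = 0,...,w-1}, where (γ_0,...,γ_{m-1}) and (δ_0,...,δ_{m-1}) are the base-p digit vectors of γ and δ (most significant first). Then B_τ(e1,e2) is nonempty if and only if p^{m-w}(D−1) + 1 ≤ τ ≤ p^{m-w}(D+1) − 1. -/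
namespace QCCS

/-- The set `B_τ(e1,e2)` of pairs `(γ,δ)` with `δ = γ + τ`, `0 ≤ γ ≤ p^m - τ - 1`,
the first `w` base-`p` digits of `γ` equal to `e1` and those of `δ` equal to `e2`. -/
def Bset (p m w : ℕ) (e1 e2 : Fin w → Fin p) (τ : ℕ) : Finset (ℕ × ℕ) :=
  Finset.filter (fun gd =>
      gd.2 = gd.1 + τ ∧ gd.1 ≤ p ^ m - τ - 1 ∧
      ∀ a : Fin w, gd.1 / p ^ (m - 1 - (a : ℕ)) % p = (e1 a : ℕ)
        ∧ gd.2 / p ^ (m - 1 - (a : ℕ)) % p = (e2 a : ℕ))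
    (Finset.range (p ^ m) ×ˢ Finset.range (p ^ m))

/-- The value of a digit vector. -/
def Eval (p w : ℕ) (e : Fin w → Fin p) : ℕ := ∑ a : Fin w, (e a : ℕ) * p ^ (w - 1 - (a : ℕ))

theorem Eval_succ (p w : ℕ) (e : Fin (w + 1) → Fin p) :
    Eval p (w + 1) e = p * Eval p w (fun a => e a.castSucc) + (e (Fin.last w) : ℕ) := by
  unfold Eval
  rw [Fin.sum_univ_castSucc, Finset.mul_sum]
  congr 1
  · refine Finset.sum_congr rfl fun a _ => ?_
    have ha := a.2
    have h : w + 1 - 1 - ((a.castSucc : Fin (w + 1)) : ℕ) = (w - 1 - (a : ℕ)) + 1 := by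
      simp only [Fin.val_castSucc]; omega
    rw [h, pow_succ]; ring
  · simp

theorem Eval_lt (p w : ℕ) (e : Fin w → Fin p) : Eval p w e < p ^ w := by
  induction w with
  | zero => simp [Eval]
  | succ w ih =>
    rw [Eval_succ, pow_succ]
    have h1 := ih (fun a => e a.castSucc)
    have h2 := (e (Fin.last w)).2
    nlinarith

theorem digits_iff {p m w : ℕ} (hp : 0 < p) (hw : w ≤ m) (e : Fin w → Fin p) (x : ℕ)
    (hx : x < p ^ m) :
    (∀ a : Fin w, x / p ^ (m - 1 - (a : ℕ)) % p = (e a : ℕ)) ↔ x / p ^ (m - w) = Eval p w e := by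
  induction w with
  | zero => simp [Eval, Nat.div_eq_of_lt hx]
  | succ w ih =>
    rw [Fin.forall_fin_succ', Eval_succ]
    have ih' := ih (by omega) (fun a => e a.castSucc)
    simp only [Fin.val_castSucc, Fin.val_last]
    rw [ih']
    have h : m - w = (m - 1 - w) + 1 := by omega
    have h' : m - (w + 1) = m - 1 - w := by omega
    rw [h, h', pow_succ, ← Nat.div_div_eq_div_mul]
    have h2 := (e (Fin.last w)).2
    generalize x / p ^ (m - 1 - w) = y
    constructor
    · rintro ⟨h3, h4⟩
      rw [← h3, ← h4, Nat.div_add_mod]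
    · rintro rfl
      constructor
      · rw [Nat.mul_add_div hp, Nat.div_eq_of_lt h2, add_zero]
      · rw [Nat.mul_add_mod, Nat.mod_eq_of_lt h2]

theorem Dval_eq (p w : ℕ) (e1 e2 : Fin w → Fin p) :
    Dval p w e1 e2 = (Eval p w e2 : ℤ) - (Eval p w e1 : ℤ) := by
  unfold Dval Eval
  push_cast
  rw [← Finset.sum_sub_distrib]
  exact Finset.sum_congr rfl fun a _ => by ring

theorem stmt12 {p m w : ℕ} (hp : p.Prime) (hm : 1 ≤ m) (hw : w ≤ m - 1)
    (e1 e2 : Fin w → Fin p) (τ : ℕ) (hτ : τ ≤ p ^ m - 1) :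
    (Bset p m w e1 e2 τ).Nonempty ↔
      ((p : ℤ) ^ (m - w) * (Dval p w e1 e2 - 1) + 1 ≤ (τ : ℤ)
        ∧ (τ : ℤ) ≤ (p : ℤ) ^ (m - w) * (Dval p w e1 e2 + 1) - 1) := by
  have hp0 := hp.pos
  have hwm : w ≤ m := by omega
  have hm0 : 0 < p ^ m := Nat.pow_pos hp0
  have hP0 : 0 < p ^ (m - w) := Nat.pow_pos hp0
  have hpm : p ^ m = p ^ w * p ^ (m - w) := by rw [← pow_add]; congr 1; omega
  have hE1 := Eval_lt p w e1
  have hE2 := Eval_lt p w e2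
  have d1 := fun x => digits_iff hp0 hwm e1 x
  have d2 := fun x => digits_iff hp0 hwm e2 x
  rw [Dval_eq]
  have hc : ((p : ℤ) ^ (m - w)) = ((p ^ (m - w) : ℕ) : ℤ) := by push_cast; rfl
  rw [hc]
  generalize Eval p w e1 = E1 at *
  generalize Eval p w e2 = E2 at *
  constructor
  · rintro ⟨⟨g, d⟩, h⟩
    simp only [Bset, Finset.mem_filter, Finset.mem_product, Finset.mem_range] at h
    obtain ⟨⟨hg, hd⟩, hgd, -, hdig⟩ := h
    have h1 := (d1 g hg).1 fun a => (hdig a).1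
    have h2 := (d2 d hd).1 fun a => (hdig a).2
    generalize p ^ (m - w) = P at *
    have a1 := Nat.div_add_mod g P
    have a2 := Nat.div_add_mod d P
    have b1 := Nat.mod_lt g hP0
    have b2 := Nat.mod_lt d hP0
    rw [h1] at a1
    rw [h2] at a2
    generalize g % P = r at *
    generalize d % P = s at *
    have r0 : 0 ≤ r := Nat.zero_le r
    have s0 : 0 ≤ s := Nat.zero_le s
    zify at a1 a2 b1 b2 hgd r0 s0
    constructor <;> nlinarith
  · rintro ⟨h1, h2⟩
    have key : ∃ r s : ℕ, r < p ^ (m - w) ∧ s < p ^ (m - w) ∧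
        p ^ (m - w) * E2 + s = p ^ (m - w) * E1 + r + τ := by
      generalize p ^ (m - w) = P at *
      rw [mul_sub, mul_sub] at h1
      rw [mul_add, mul_sub] at h2
      rcases le_total (P * E2) (P * E1 + τ) with h | h
      · refine ⟨0, P * E1 + τ - P * E2, hP0, ?_, by omega⟩
        zify [h]; linarith
      · refine ⟨P * E2 - (P * E1 + τ), 0, ?_, hP0, by omega⟩
        zify [h]; linarith
    obtain ⟨r, s, hr, hs, hrs⟩ := key
    have hg : p ^ (m - w) * E1 + r < p ^ m := by rw [hpm]; nlinarith
    have hd : p ^ (m - w) * E2 + s < p ^ m := by rw [hpm]; nlinarith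
    refine ⟨(p ^ (m - w) * E1 + r, p ^ (m - w) * E2 + s), ?_⟩
    simp only [Bset, Finset.mem_filter, Finset.mem_product, Finset.mem_range]
    refine ⟨⟨hg, hd⟩, hrs, by omega, fun a => ⟨(d1 _ hg).2 ?_ a, (d2 _ hd).2 ?_ a⟩⟩
    · rw [Nat.mul_add_div hP0, Nat.div_eq_of_lt hr, add_zero]
    · rw [Nat.mul_add_div hP0, Nat.div_eq_of_lt hs, add_zero]
end QCCS
end

section
/- Let p be an odd prime, λ a positive multiple of p, m ≥ 1, 0 ≤ w ≤ m-1, k1 ≠ k2 ∈ {1,...,p-1}, S = {(e1,e2) : e1, e2 ∈ {0,...,p-1}^w, k1·e1 ≡ k2·e2 (mod p) componentwise}, and J1 = {0,...,w-1}. Suppose 0 ≤ τ ≤ p^m − 1 is such that for every (e1,e2) ∈ S with D = Σ_{α=0}^{w-1}(e_{2,α} − e_{1,α})p^{w-1-α}, τ does not lie in the interval [p^{m-w}(D−1)+1, p^{m-w}(D+1)−1]. Then for any g, h : {0,1,...,p-1}^m → ℤ_λ, Σ_{(e1,e2) ∈ S} Θ(ψ(g|_{x_{J1}=e1}), ψ(h|_{x_{J1}=e2}))(τ)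 = 0. -/
open Finset

noncomputable section

namespace QCCS

theorem digit_sum (p w n : ℕ) :
    ∑ a : Fin w, (n / p ^ (w - 1 - (a : ℕ)) % p) * p ^ (w - 1 - (a : ℕ)) = n % p ^ w := by
  induction w with
  | zero => simp [Nat.mod_one]
  | succ w ih =>
    rw [Fin.sum_univ_succ, Nat.mod_pow_succ, ← ih]
    have : ∀ a : Fin w, w + 1 - 1 - (a.succ : ℕ) = w - 1 - (a : ℕ) := by
      intro a
      rw [Fin.val_succ]
      omega
    simp only [this]
    simp
    ring

theorem leading_sum {p m w : ℕ} [NeZero p] (hw : w ≤ m) (i : ℕ) (hi : i < p ^ m)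
    (c : Fin w → Fin p) (J : Fin w → Fin m) (hJ : ∀ a, (J a : ℕ) = a)
    (hc : ∀ a, digitVec p m i (J a) = c a) :
    ∑ a : Fin w, ((c a : ℕ) : ℤ) * (p : ℤ) ^ (w - 1 - (a : ℕ)) = ((i / p ^ (m - w) : ℕ) : ℤ) := by
  have h1 : i / p ^ (m - w) < p ^ w := by
    apply Nat.div_lt_of_lt_mul
    rwa [← pow_add, Nat.sub_add_cancel hw]
  have h2 := digit_sum p w (i / p ^ (m - w))
  rw [Nat.mod_eq_of_lt h1] at h2
  rw [← h2]
  push_cast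
  refine Finset.sum_congr rfl fun a _ => ?_
  congr 1
  rw [← hc a]
  have : m - 1 - (a : ℕ) = (m - w) + (w - 1 - (a : ℕ)) := by
    have := a.isLt
    omega
  simp only [digitVec, hJ, this, pow_add, ← Nat.div_div_eq_div_mul]
  push_cast
  rfl

theorem neg_val_add {p : ℕ} [NeZero p] (x : Fin p) (hx : (x : ℕ) ≠ 0) :
    ((-x : Fin p) : ℕ) + x = p := by
  have := x.isLt
  rw [Fin.val_neg', Nat.mod_eq_of_lt (by omega)]
  omega

theorem neg_val_zero {p : ℕ} [NeZero p] (x : Fin p) (hx : (x : ℕ) = 0) :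
    ((-x : Fin p) : ℕ) = 0 := by
  rw [Fin.val_neg', hx]
  simp

theorem neg_cast {p : ℕ} [NeZero p] (x : Fin p) :
    (((-x : Fin p) : ℕ) : ZMod p) = -((x : ℕ) : ZMod p) := by
  by_cases hx : (x : ℕ) = 0
  · rw [neg_val_zero x hx, hx]; simp
  · have := congrArg (Nat.cast : ℕ → ZMod p) (neg_val_add x hx)
    push_cast at this
    rw [CharP.cast_eq_zero (ZMod p) p] at this
    exact eq_neg_of_add_eq_zero_left this

theorem zero_of_rel {p : ℕ} (hp : p.Prime) {k1 k2 : ℕ} (h1 : 1 ≤ k1) (h2 : k1 ≤ p - 1)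
    (x y : Fin p) (hxy : ((k1 * (x : ℕ) : ℕ) : ZMod p) = ((k2 * (y : ℕ) : ℕ) : ZMod p))
    (hy : (y : ℕ) = 0) : (x : ℕ) = 0 := by
  rw [hy, mul_zero, Nat.cast_zero, ZMod.natCast_eq_zero_iff, hp.dvd_mul] at hxy
  have := hp.two_le
  rcases hxy with h | h
  · have := Nat.le_of_dvd (by omega) h
    omega
  · exact Nat.eq_zero_of_dvd_of_lt h x.isLt

theorem stmt14 {p lam m w : ℕ} [NeZero p] (hp : p.Prime) (hodd : Odd p)
    (hlam : 0 < lam) (hdvd : p ∣ lam) (hm : 1 ≤ m) (hw : w ≤ m - 1)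
    (k1 k2 : ℕ) (hk11 : 1 ≤ k1) (hk12 : k1 ≤ p - 1) (hk21 : 1 ≤ k2) (hk22 : k2 ≤ p - 1)
    (hk : k1 ≠ k2)
    (τ : ℕ) (hτ : τ ≤ p ^ m - 1)
    (havoid : ∀ e : (Fin w → Fin p) × (Fin w → Fin p),
      (∀ a, ((k1 * (e.1 a : ℕ) : ℕ) : ZMod p) = ((k2 * (e.2 a : ℕ) : ℕ) : ZMod p)) →
      ¬((p : ℤ) ^ (m - w) * (Dval p w e.1 e.2 - 1) + 1 ≤ (τ : ℤ)
          ∧ (τ : ℤ) ≤ (p : ℤ) ^ (m - w) * (Dval p w e.1 e.2 + 1) - 1))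
    (g h : (Fin m → Fin p) → ZMod lam) :
    ∑ e ∈ Finset.filter
        (fun e : (Fin w → Fin p) × (Fin w → Fin p) =>
          ∀ a, ((k1 * (e.1 a : ℕ) : ℕ) : ZMod p) = ((k2 * (e.2 a : ℕ) : ℕ) : ZMod p))
        Finset.univ,
      corr (p ^ m)
        (psiRes p lam m w g (fun a => Fin.castLE (by omega) a) e.1)
        (psiRes p lam m w h (fun a => Fin.castLE (by omega) a) e.2) (τ : ℤ)
      = 0 := by
  have hwm : w ≤ m := by omega
  refine Finset.sum_eq_zero fun e he => ?_
  have hS := (Finset.mem_filter.mp he).2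
  unfold corr
  refine Finset.sum_eq_zero fun i hi => ?_
  have hi := Finset.mem_range.mp hi
  split_ifs with hr
  swap
  · rfl
  have hr2 : i + τ < p ^ m := by exact_mod_cast hr.2
  have hnat : ((i : ℤ) + (τ : ℤ)).toNat = i + τ := by omega
  rw [hnat]
  unfold psiRes
  split_ifs with hA hB
  · exfalso
    have sA := leading_sum hwm (i + τ) hr2 e.1 _ (fun a => rfl) hA
    have sB := leading_sum hwm i hi e.2 _ (fun a => rfl) hB
    have hD : Dval p w (fun a => -e.1 a) (fun a => -e.2 a)
        = (((i + τ) / p ^ (m - w) : ℕ) : ℤ) - ((i / p ^ (m - w) : ℕ) : ℤ) := by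
      rw [← sA, ← sB, ← Finset.sum_sub_distrib]
      unfold Dval
      refine Finset.sum_congr rfl fun a _ => ?_
      rw [← sub_mul]
      congr 1
      by_cases hy : (e.2 a : ℕ) = 0
      · have hx := zero_of_rel hp hk11 hk12 _ _ (hS a) hy
        rw [neg_val_zero _ hy, neg_val_zero _ hx, hx, hy]
      · have hx : (e.1 a : ℕ) ≠ 0 := fun hx => hy (zero_of_rel hp hk21 hk22 _ _ (hS a).symm hx)
        have h1 := neg_val_add _ hx
        have h2 := neg_val_add _ hy
        beta_reduce
        omega
    refine havoid (fun a => -e.1 a, fun a => -e.2 a) ?_ ?_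
    · intro a
      have := hS a
      push_cast at this ⊢
      rw [neg_cast, neg_cast, mul_neg, mul_neg, this]
    · simp only [hD]
      have hq : 0 < p ^ (m - w) := pow_pos hp.pos _
      have a1 := Nat.div_add_mod (i + τ) (p ^ (m - w))
      have a2 := Nat.mod_lt (i + τ) hq
      have b1 := Nat.div_add_mod i (p ^ (m - w))
      have b2 := Nat.mod_lt i hq
      rw [← Nat.cast_pow]
      generalize p ^ (m - w) = q at *
      generalize (i + τ) / q = A at *
      generalize (i + τ) % q = r at *
      generalize i / q = B at *
      generalize i % q = t at *
      zify at a1 a2 b1 b2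
      constructor <;> nlinarith
  · simp
  · simp
  · simp
end QCCS
end
end

section
/- Let p be a prime, λ a positive multiple of p, m ≥ 1, 0 ≤ n ≤ m-1, J = {j_0,...,j_{n-1}} ⊆ {0,...,m-1}, and let f : {0,1,...,p-1}^m → ℤ_λ be any multivariate function. Let k ∈ {1,...,p-1}, t, t' ∈ {0,...,p^{n+1}-1}, and let l, l' be (not necessarily distinct) indices in {0,...,m-1} \ J. For d ∈ {0,...,p^{n+1}-1} with base-p digits (d_0,...,d_n) and 𝐝 = (d_0,...,d_{n-1}), define f_{d,t} = f + (kλ/p)(𝐝·𝐱_J + d_n x_l) + (λ/p)(𝐭·𝐱_J + t_n x_{l'}), where (t_0,...,t_n) are the base-p digits of t and 𝐭 = (t_0,...,t_{n-1}). Then for every integer τ with |τ| < p^m, Σ_{d=0}^{p^{n+1}-1} Σ_{c1 ≠ c2 ∈ {0,...,p-1}^n} Θ(ψ(f_{d,t}|_{x_J=c1}), ψ(f_{d,t'}|_{x_J=c2}))(τ) = 0. -/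
open Finset

noncomputable section

namespace QCCS

lemma zeta_prim {lam : ℕ} (hlam : 0 < lam) : IsPrimitiveRoot (zeta lam) lam :=
  Complex.isPrimitiveRoot_exp lam hlam.ne'

lemma zeta_val_natCast {lam : ℕ} (hlam : 0 < lam) (N : ℕ) :
    zeta lam ^ ((N : ZMod lam)).val = zeta lam ^ N := by
  rw [ZMod.val_natCast, ← pow_eq_pow_mod N (zeta_prim hlam).pow_eq_one]

lemma zeta_val_add {lam : ℕ} (hlam : 0 < lam) (x y : ZMod lam) :
    zeta lam ^ (x + y).val = zeta lam ^ x.val * zeta lam ^ y.val := by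
  have : NeZero lam := ⟨hlam.ne'⟩
  rw [ZMod.val_add, ← pow_eq_pow_mod _ (zeta_prim hlam).pow_eq_one, pow_add]

lemma sum_digitVec {p : ℕ} [NeZero p] (N : ℕ) (F : (Fin N → Fin p) → ℂ) :
    ∑ d ∈ Finset.range (p ^ N), F (digitVec p N d) = ∑ g : Fin N → Fin p, F g := by
  rw [← Fin.sum_univ_eq_sum_range (fun d => F (digitVec p N d))]
  refine Fintype.sum_equiv
    (finFunctionFinEquiv.symm.trans (Equiv.arrowCongr Fin.revPerm (Equiv.refl _))) _ _ ?_
  intro d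
  congr 1
  funext a
  apply Fin.ext
  simp [digitVec, finFunctionFinEquiv, Fin.val_rev]
  congr 3
  omega

lemma key {p N : ℕ} [NeZero p] (w : ℂ) (hw : IsPrimitiveRoot w p)
    (hc : w * (starRingEnd ℂ) w = 1) (u v : Fin N → Fin p) (h : ∃ a, u a ≠ v a) :
    ∑ d ∈ Finset.range (p ^ N), w ^ (∑ b, (digitVec p N d b : ℕ) * (u b : ℕ)) *
      (starRingEnd ℂ) (w ^ (∑ b, (digitVec p N d b : ℕ) * (v b : ℕ))) = 0 := by
  rw [sum_digitVec N (fun g => w ^ (∑ b, (g b : ℕ) * (u b : ℕ)) *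
      (starRingEnd ℂ) (w ^ (∑ b, (g b : ℕ) * (v b : ℕ))))]
  have h1 : ∀ g : Fin N → Fin p, w ^ (∑ b, (g b : ℕ) * (u b : ℕ)) *
      (starRingEnd ℂ) (w ^ (∑ b, (g b : ℕ) * (v b : ℕ))) =
      ∏ b, (w ^ (u b : ℕ) * (starRingEnd ℂ) w ^ (v b : ℕ)) ^ (g b : ℕ) := by
    intro g
    rw [map_pow, ← Finset.prod_pow_eq_pow_sum, ← Finset.prod_pow_eq_pow_sum,
      ← Finset.prod_mul_distrib]
    refine Finset.prod_congr rfl fun b _ => ?_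
    rw [mul_pow, ← pow_mul, ← pow_mul, mul_comm (g b : ℕ), mul_comm (g b : ℕ)]
  rw [Finset.sum_congr rfl fun g _ => h1 g]
  have h2 := Fintype.prod_sum
    (fun (b : Fin N) (e : Fin p) => (w ^ (u b : ℕ) * (starRingEnd ℂ) w ^ (v b : ℕ)) ^ (e : ℕ))
  rw [← h2]
  obtain ⟨a, ha⟩ := h
  refine Finset.prod_eq_zero (Finset.mem_univ a) ?_
  rw [Fin.sum_univ_eq_sum_range
    (fun e => (w ^ (u a : ℕ) * (starRingEnd ℂ) w ^ (v a : ℕ)) ^ e)]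
  have hr1 : w ^ (u a : ℕ) * (starRingEnd ℂ) w ^ (v a : ℕ) ≠ 1 := by
    intro h
    apply ha
    apply Fin.ext
    apply hw.pow_inj (u a).2 (v a).2
    calc w ^ (u a : ℕ) = w ^ (u a : ℕ) * (w * (starRingEnd ℂ) w) ^ (v a : ℕ) := by
          rw [hc]; simp
      _ = (w ^ (u a : ℕ) * (starRingEnd ℂ) w ^ (v a : ℕ)) * w ^ (v a : ℕ) := by
          rw [mul_pow]; ring
      _ = _ := by rw [h, one_mul]
  have hp1 : (w ^ (u a : ℕ) * (starRingEnd ℂ) w ^ (v a : ℕ)) ^ p = 1 := by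
    rw [mul_pow, ← pow_mul, ← pow_mul, mul_comm _ p, mul_comm _ p, pow_mul, pow_mul, ← map_pow,
      hw.pow_eq_one]
    simp
  rw [geom_sum_eq hr1, hp1]
  simp

lemma psi_codeword {p lam m n : ℕ} [NeZero p] (hlam : 0 < lam)
    (f : (Fin m → Fin p) → ZMod lam) (J : Fin n → Fin m) (l l' : Fin m) (k t : ℕ) (i : ℕ) :
    ∃ C : ℂ, ∀ d, psi p lam m (codeword p lam m n f J l l' k d t) i =
      C * (zeta lam ^ (k * (lam / p))) ^ (∑ b, (digitVec p (n + 1) d b : ℕ) *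
        ((Fin.snoc (fun a => digitVec p m i (J a)) (digitVec p m i l) :
          Fin (n + 1) → Fin p) b : ℕ)) := by
  refine ⟨zeta lam ^ (f (digitVec p m i)).val * zeta lam ^ (((lam / p *
        ((∑ a : Fin n, (digitVec p (n + 1) t a.castSucc : ℕ) * (digitVec p m i (J a) : ℕ))
          + (digitVec p (n + 1) t (Fin.last n) : ℕ) * (digitVec p m i l' : ℕ))))), ?_⟩
  intro d
  unfold psi codeword
  rw [zeta_val_add hlam, zeta_val_add hlam, zeta_val_natCast hlam, zeta_val_natCast hlam,
    Fin.sum_univ_castSucc]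
  simp only [Fin.snoc_castSucc, Fin.snoc_last]
  rw [← pow_mul]
  ring

theorem stmt15 {p lam m n : ℕ} [NeZero p] (hp : p.Prime)
    (hlam : 0 < lam) (hdvd : p ∣ lam) (hm : 1 ≤ m) (hn : n ≤ m - 1)
    (f : (Fin m → Fin p) → ZMod lam)
    (J : Fin n → Fin m) (hJ : Function.Injective J)
    (k : ℕ) (hk1 : 1 ≤ k) (hk2 : k ≤ p - 1)
    (l l' : Fin m) (hl : ¬∃ a, J a = l) (hl' : ¬∃ a, J a = l')
    (t t' : ℕ) (ht : t < p ^ (n + 1)) (ht' : t' < p ^ (n + 1))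
    (τ : ℤ) (hτ : |τ| < (p : ℤ) ^ m) :
    ∑ d ∈ Finset.range (p ^ (n + 1)),
      ∑ c1 : Fin n → Fin p, ∑ c2 : Fin n → Fin p,
        (if c1 = c2 then 0 else
          corr (p ^ m)
            (psiRes p lam m n (codeword p lam m n f J l l' k d t) J c1)
            (psiRes p lam m n (codeword p lam m n f J l l' k d t') J c2) τ)
      = 0 := by
  have hz := zeta_prim hlam
  have hw : IsPrimitiveRoot (zeta lam ^ (k * (lam / p))) p := by
    have h1 : IsPrimitiveRoot (zeta lam ^ (lam / p)) p :=
      hz.pow hlam (Nat.div_mul_cancel hdvd).symm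
    rw [mul_comm, pow_mul]
    refine h1.pow_of_coprime k ?_
    have := hp.two_le
    exact (Nat.coprime_of_lt_prime (by omega) (by omega) hp).symm
  have hc : zeta lam ^ (k * (lam / p)) * (starRingEnd ℂ) (zeta lam ^ (k * (lam / p))) = 1 := by
    have := hw.norm'_eq_one hp.ne_zero
    rw [Complex.mul_conj, Complex.normSq_eq_norm_sq, this]
    simp
  rw [Finset.sum_comm]
  refine Finset.sum_eq_zero fun c1 _ => ?_
  rw [Finset.sum_comm]
  refine Finset.sum_eq_zero fun c2 _ => ?_
  by_cases hcc : c1 = c2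
  · simp [hcc]
  simp only [if_neg hcc, corr]
  rw [Finset.sum_comm]
  refine Finset.sum_eq_zero fun i _ => ?_
  split_ifs with hi
  swap
  · simp
  generalize ((i : ℤ) + τ).toNat = j
  unfold psiRes
  by_cases h1 : ∀ a, digitVec p m j (J a) = c1 a
  swap
  · simp [h1]
  by_cases h2 : ∀ a, digitVec p m i (J a) = c2 a
  swap
  · simp [h2]
  simp only [if_pos h1, if_pos h2]
  obtain ⟨C, hC⟩ := psi_codeword hlam f J l l' k t j
  obtain ⟨D, hD⟩ := psi_codeword hlam f J l l' k t' i
  have hk := key (N := n + 1) _ hw hc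
    (Fin.snoc (fun a => digitVec p m j (J a)) (digitVec p m j l))
    (Fin.snoc (fun a => digitVec p m i (J a)) (digitVec p m i l)) (by
      obtain ⟨a, ha⟩ := Function.ne_iff.mp hcc
      refine ⟨a.castSucc, ?_⟩
      rw [Fin.snoc_castSucc, Fin.snoc_castSucc, h1, h2]
      exact ha)
  rw [← mul_zero (C * (starRingEnd ℂ) D), ← hk, Finset.mul_sum]
  refine Finset.sum_congr rfl fun d _ => ?_
  rw [hC, hD, map_mul]
  ring
end QCCS
end
end

section
/- Let p be a prime, λ a positive multiple of p, m ≥ 1, 0 ≤ n ≤ m-2, J = {j_0,...,j_{n-1}} ⊆ {0,...,m-1}, and let f : {0,1,...,p-1}^m → ℤ_λ satisfy the Hamiltonian-path condition with respect to J with permutation π of {0,...,m-n-1}, where {l_0,...,l_{m-n-1}} = {0,...,m-1} \ J. Let c ∈ {0,...,p-1}^n, and let γ, δ be integers in [0, p^m) whose base-p digit vectors satisfy γ_{j_α} = δ_{j_α} = c_α for all α, and for which there exists u ≥ 1 with γ_{l_{π(α)}} = δ_{l_{π(α)}} for all 0 ≤ α < u and γ_{l_{π(u)}} ≠ δ_{l_{π(u)}}.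 For v ∈ {0,1,...,p-1}, let γ^v (respectively δ^v) be the integer whose base-p digit vector agrees with that of γ (resp. δ) except that the digit at position l_{π(u-1)} is replaced by (γ_{l_{π(u-1)}} − v) mod p (resp. (δ_{l_{π(u-1)}} − v) mod p). Then Σ_{v=0}^{p-1} ξ_λ^{f(γ^v digits) − f(δ^v digits)} = 0, where ξ_λ = exp(2π√(-1)/λ). -/
open Finset

noncomputable section

namespace QCCS

/-- Replace the base-`p` digit of `γ` at position `pos` by `newd % p`,
keeping all other digits. -/
def modifyDigit (p m : ℕ) [NeZero p] (γ : ℕ) (pos : Fin m) (newd : ℕ) : ℕ :=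
  ∑ a : Fin m,
    (if a = pos then newd % p else (digitVec p m γ a : ℕ)) * p ^ (m - 1 - (a : ℕ))

lemma digitVec_sum (p m : ℕ) [NeZero p] (w : Fin m → Fin p) :
    digitVec p m (∑ a : Fin m, (w a : ℕ) * p ^ (m - 1 - (a : ℕ))) = w := by
  have key : (∑ a : Fin m, (w a : ℕ) * p ^ (m - 1 - (a : ℕ)))
      = (finFunctionFinEquiv (fun i : Fin m => w (Fin.rev i)) : ℕ) := by
    rw [finFunctionFinEquiv_apply, ← Equiv.sum_comp Fin.revPerm]
    refine Finset.sum_congr rfl fun a _ => ?_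
    simp only [Fin.revPerm_apply, Fin.val_rev]
    congr 2
    omega
  have h2 := finFunctionFinEquiv.symm_apply_apply (fun i : Fin m => w (Fin.rev i))
  funext a
  have h3 := congrFun h2 (Fin.rev a)
  rw [Fin.rev_rev] at h3
  rw [← h3]
  apply Fin.ext
  rw [finFunctionFinEquiv_symm_apply_val]
  simp only [digitVec]
  rw [key, Fin.val_rev]
  congr 3
  omega

lemma digitVec_modify (p m : ℕ) [NeZero p] (γ : ℕ) (pos : Fin m) (d : Fin p) :
    digitVec p m (modifyDigit p m γ pos (d : ℕ)) = Function.update (digitVec p m γ) pos d := by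
  rw [← digitVec_sum p m (Function.update (digitVec p m γ) pos d)]
  congr 1
  unfold modifyDigit
  refine Finset.sum_congr rfl fun a _ => ?_
  congr 1
  by_cases h : a = pos
  · subst h
    simp [Nat.mod_eq_of_lt d.isLt]
  · simp [h]

lemma zeta_pow_val (lam : ℕ) [NeZero lam] (x : ZMod lam) :
    zeta lam ^ x.val = ZMod.stdAddChar x := by
  conv_rhs => rw [← ZMod.natCast_zmod_val x]
  have := ZMod.stdAddChar_coe (N := lam) (x.val : ℤ)
  push_cast at this
  rw [this, zeta, ← Complex.exp_nat_mul]
  congr 1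
  ring

/-- Key difference identity. -/
lemma diff_identity {p lam m n : ℕ} [NeZero p]
    (J : Fin n → Fin m) (l : Fin (m - n) → Fin m) (hl : Function.Injective l)
    (π : Equiv.Perm (Fin (m - n))) (f : (Fin m → Fin p) → ZMod lam)
    (hHPC : hamiltonianPathCond p lam m n f J l π) (c : Fin n → Fin p)
    (hcompl : ∀ i : Fin m, (∃ b, l b = i) ↔ ¬∃ a, J a = i)
    (X Y : Fin m → Fin p) (hX : ∀ a, X (J a) = c a) (hY : ∀ a, Y (J a) = c a)
    (k : ℕ) (hk : k + 1 < m - n)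
    (hagree : ∀ a : Fin (m - n), (a : ℕ) < k → X (l (π a)) = Y (l (π a)))
    (d : Fin p) :
    f (Function.update X (l (π ⟨k, by omega⟩)) d) - f (Function.update Y (l (π ⟨k, by omega⟩)) d)
    = (f (Function.update X (l (π ⟨k, by omega⟩)) 0)
        - f (Function.update Y (l (π ⟨k, by omega⟩)) 0))
      + ((d : ℕ) : ZMod lam) * (((lam / p : ℕ) : ZMod lam) *
        (((X (l (π ⟨k + 1, hk⟩)) : ℕ) : ZMod lam) - ((Y (l (π ⟨k + 1, hk⟩)) : ℕ) : ZMod lam))) := by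
  obtain ⟨g, g', hf⟩ := hHPC c
  set pos := l (π ⟨k, by omega⟩) with hpos
  have hJpos : ∀ a, J a ≠ pos := fun a h => (hcompl pos).1 ⟨_, rfl⟩ ⟨a, h⟩
  have hres : ∀ (Z : Fin m → Fin p), (∀ a, Z (J a) = c a) → ∀ e : Fin p,
      ∀ a, Function.update Z pos e (J a) = c a := by
    intro Z hZ e a
    rw [Function.update_of_ne (hJpos a), hZ]
  rw [hf _ (hres X hX d), hf _ (hres Y hY d), hf _ (hres X hX 0), hf _ (hres Y hY 0)]
  have hlin : (∑ a, g a * ((Function.update X pos d (l a) : ℕ) : ZMod lam))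
      - (∑ a, g a * ((Function.update Y pos d (l a) : ℕ) : ZMod lam))
      - (∑ a, g a * ((Function.update X pos 0 (l a) : ℕ) : ZMod lam))
      + (∑ a, g a * ((Function.update Y pos 0 (l a) : ℕ) : ZMod lam)) = 0 := by
    rw [← Finset.sum_sub_distrib, ← Finset.sum_sub_distrib, ← Finset.sum_add_distrib]
    refine Finset.sum_eq_zero fun a _ => ?_
    by_cases h : l a = pos
    · simp [h]
    · simp [Function.update_of_ne h]
  have hne : ∀ a : Fin (m - n), (a : ℕ) ≠ k → l (π a) ≠ pos := by
    intro a ha h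
    apply ha
    have := π.injective (hl h)
    rw [this]
  let Q : (Fin m → Fin p) → Fin (m - n) → ZMod lam := fun x a =>
    if h : (a : ℕ) + 1 < m - n then
      ((x (l (π a)) : ℕ) : ZMod lam) * ((x (l (π ⟨(a : ℕ) + 1, h⟩)) : ℕ) : ZMod lam)
    else 0
  have hQ : ∀ x : Fin m → Fin p, ((lam / p * ∑ a : Fin (m - n),
            (if h : (a : ℕ) + 1 < m - n then
              (x (l (π a)) : ℕ) * (x (l (π ⟨(a : ℕ) + 1, h⟩)) : ℕ)
            else 0) : ℕ) : ZMod lam) = ((lam / p : ℕ) : ZMod lam) * ∑ a, Q x a := by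
    intro x
    rw [Nat.cast_mul, Nat.cast_sum]
    congr 1
    refine Finset.sum_congr rfl fun a _ => ?_
    simp only [Q]
    split_ifs <;> simp
  have hquad : (∑ a, Q (Function.update X pos d) a) - (∑ a, Q (Function.update Y pos d) a)
      - (∑ a, Q (Function.update X pos 0) a) + (∑ a, Q (Function.update Y pos 0) a)
      = ((d : ℕ) : ZMod lam) * (((X (l (π ⟨k + 1, hk⟩)) : ℕ) : ZMod lam)
          - ((Y (l (π ⟨k + 1, hk⟩)) : ℕ) : ZMod lam)) := by
    rw [← Finset.sum_sub_distrib, ← Finset.sum_sub_distrib, ← Finset.sum_add_distrib]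
    rw [Finset.sum_eq_single (⟨k, by omega⟩ : Fin (m - n))]
    · have h1 := hne ⟨k + 1, hk⟩ (by simp)
      simp only [Q, dif_pos hk, ← hpos, Function.update_self, Function.update_of_ne h1]
      simp
      ring
    · intro a _ ha
      have hak : (a : ℕ) ≠ k := fun h => ha (Fin.ext h)
      simp only [Q]
      by_cases h : (a : ℕ) + 1 < m - n
      · simp only [dif_pos h, Function.update_of_ne (hne a hak)]
        by_cases h2 : (a : ℕ) + 1 = k
        · rw [hagree a (by omega)]
          have h3 : l (π ⟨(a : ℕ) + 1, h⟩) = pos := by simp only [h2, hpos]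
          simp only [h3, Function.update_self]
          ring
        · simp only [Function.update_of_ne (hne ⟨(a : ℕ) + 1, h⟩ h2)]
          ring
      · simp [h]
    · simp
  rw [hQ, hQ, hQ, hQ]
  linear_combination hlin + ((lam / p : ℕ) : ZMod lam) * hquad

/-- The reversal-and-shift of digits. -/
lemma shift_bij {p : ℕ} [NeZero p] (e : Fin p) :
    Function.Bijective (fun v : Fin p =>
      (⟨((e : ℕ) + p - (v : ℕ)) % p, Nat.mod_lt _ (Nat.pos_of_ne_zero (NeZero.ne p))⟩ : Fin p)) := by
  have : (fun v : Fin p =>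
      (⟨((e : ℕ) + p - (v : ℕ)) % p, Nat.mod_lt _ (Nat.pos_of_ne_zero (NeZero.ne p))⟩ : Fin p))
      = fun v => e - v := by
    funext v
    apply Fin.ext
    rw [Fin.val_sub]
    simp only
    congr 1
    omega
  rw [this]
  exact (Equiv.subLeft e).bijective

lemma char_sum_zero {p lam : ℕ} [NeZero lam] (hp : p.Prime) (hdvd : p ∣ lam)
    (C : ZMod lam) (a b : Fin p) (hab : a ≠ b) :
    ∑ d : Fin p, (ZMod.stdAddChar (C + ((d : ℕ) : ZMod lam) * (((lam / p : ℕ) : ZMod lam) *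
        (((a : ℕ) : ZMod lam) - ((b : ℕ) : ZMod lam)))) : ℂ) = 0 := by
  obtain ⟨q, rfl⟩ := hdvd
  have hq : q ≠ 0 := by
    rintro rfl
    exact NeZero.ne (p * 0) (by simp)
  rw [Nat.mul_div_cancel_left q hp.pos]
  set s : ZMod (p * q) := ((q : ℕ) : ZMod (p * q)) *
        (((a : ℕ) : ZMod (p * q)) - ((b : ℕ) : ZMod (p * q))) with hs
  have hps : (p : ZMod (p * q)) * s = 0 := by
    have : ((p : ZMod (p * q)) * (q : ZMod (p * q))) = 0 := by
      rw [← Nat.cast_mul]; exact ZMod.natCast_self _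
    rw [hs, ← mul_assoc, this, zero_mul]
  have hs0 : s ≠ 0 := by
    intro h
    rw [hs, mul_sub, sub_eq_zero, ← Nat.cast_mul, ← Nat.cast_mul,
      ZMod.natCast_eq_natCast_iff, mul_comm p q] at h
    have h2 := Nat.ModEq.mul_left_cancel' hq h
    exact hab (Fin.ext (Nat.ModEq.eq_of_lt_of_lt h2 a.isLt b.isLt))
  set ω : ℂ := ZMod.stdAddChar s with hω
  have hpow : ∀ k : ℕ, (ZMod.stdAddChar ((k : ZMod (p * q)) * s) : ℂ) = ω ^ k := by
    intro k
    rw [← nsmul_eq_mul, AddChar.map_nsmul_eq_pow]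
  have hω1 : ω ≠ 1 := by
    intro h
    apply hs0
    apply ZMod.injective_stdAddChar
    rw [← hω, h, AddChar.map_zero_eq_one]
  have hωp : ω ^ p = 1 := by
    rw [← hpow, hps, AddChar.map_zero_eq_one]
  simp only [AddChar.map_add_eq_mul, hpow]
  rw [← Finset.mul_sum, Fin.sum_univ_eq_sum_range (fun i => ω ^ i) p, geom_sum_eq hω1, hωp]
  simp

theorem stmt17 {p lam m n : ℕ} [NeZero p] (hp : p.Prime)
    (hlam : 0 < lam) (hdvd : p ∣ lam) (hm : 1 ≤ m) (hn : n ≤ m - 2)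
    (J : Fin n → Fin m) (hJ : Function.Injective J)
    (l : Fin (m - n) → Fin m) (hl : Function.Injective l)
    (hcompl : ∀ i : Fin m, (∃ b, l b = i) ↔ ¬∃ a, J a = i)
    (π : Equiv.Perm (Fin (m - n)))
    (f : (Fin m → Fin p) → ZMod lam)
    (hHPC : hamiltonianPathCond p lam m n f J l π)
    (c : Fin n → Fin p)
    (γ δ : ℕ) (hγ : γ < p ^ m) (hδ : δ < p ^ m)
    (hγc : ∀ a, digitVec p m γ (J a) = c a) (hδc : ∀ a, digitVec p m δ (J a) = c a)
    (u : ℕ) (hu1 : 1 ≤ u) (hu2 : u < m - n)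
    (hagree : ∀ a : ℕ, ∀ ha : a < u,
      digitVec p m γ (l (π ⟨a, by omega⟩)) = digitVec p m δ (l (π ⟨a, by omega⟩)))
    (hdiff : digitVec p m γ (l (π ⟨u, hu2⟩)) ≠ digitVec p m δ (l (π ⟨u, hu2⟩))) :
    ∑ v : Fin p,
      zeta lam ^
        (f (digitVec p m (modifyDigit p m γ (l (π ⟨u - 1, by omega⟩))
              (((digitVec p m γ (l (π ⟨u - 1, by omega⟩)) : ℕ) + p - (v : ℕ)) % p)))
          - f (digitVec p m (modifyDigit p m δ (l (π ⟨u - 1, by omega⟩))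
              (((digitVec p m δ (l (π ⟨u - 1, by omega⟩)) : ℕ) + p - (v : ℕ)) % p)))).val
      = 0 := by
  have : NeZero lam := ⟨hlam.ne'⟩
  obtain ⟨k, rfl⟩ : ∃ k, u = k + 1 := ⟨u - 1, by omega⟩
  simp only [Nat.add_sub_cancel]
  have hag := hagree k (by omega)
  rw [← hag]
  set e := digitVec p m γ (l (π ⟨k, by omega⟩)) with he
  let s : Fin p → Fin p := fun v =>
    ⟨((e : ℕ) + p - (v : ℕ)) % p, Nat.mod_lt _ (Nat.pos_of_ne_zero (NeZero.ne p))⟩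
  have hs : Function.Bijective s := shift_bij e
  have hterm : ∀ v : Fin p,
      zeta lam ^
        (f (digitVec p m (modifyDigit p m γ (l (π ⟨k, by omega⟩))
              (((e : ℕ) + p - (v : ℕ)) % p)))
          - f (digitVec p m (modifyDigit p m δ (l (π ⟨k, by omega⟩))
              (((e : ℕ) + p - (v : ℕ)) % p)))).val
      = (fun d : Fin p => (ZMod.stdAddChar
        ((f (Function.update (digitVec p m γ) (l (π ⟨k, by omega⟩)) 0)
        - f (Function.update (digitVec p m δ) (l (π ⟨k, by omega⟩)) 0))
      + ((d : ℕ) : ZMod lam) * (((lam / p : ℕ) : ZMod lam) *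
        (((digitVec p m γ (l (π ⟨k + 1, hu2⟩)) : ℕ) : ZMod lam)
          - ((digitVec p m δ (l (π ⟨k + 1, hu2⟩)) : ℕ) : ZMod lam)))) : ℂ)) (s v) := by
    intro v
    have h1 := digitVec_modify p m γ (l (π ⟨k, by omega⟩)) (s v)
    have h2 := digitVec_modify p m δ (l (π ⟨k, by omega⟩)) (s v)
    simp only [s] at h1 h2
    rw [h1, h2, zeta_pow_val]
    rw [diff_identity J l hl π f hHPC c hcompl (digitVec p m γ) (digitVec p m δ) hγc hδc k hu2
      (fun a ha => hagree a (by omega))]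
  rw [Finset.sum_congr rfl fun v _ => hterm v]
  have hz := char_sum_zero hp hdvd
    (f (Function.update (digitVec p m γ) (l (π ⟨k, by omega⟩)) 0)
        - f (Function.update (digitVec p m δ) (l (π ⟨k, by omega⟩)) 0)) _ _ hdiff
  rw [← hs.sum_comp] at hz
  exact hz
end QCCS
end
end
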